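/- arXiv:2605.06780 — 5 statements merged into one kernel-verified Lean document; each statement's English description precedes it below -/
import Mathlib

section
/- Swap-test overlaps are not preserved below an evanescent surface: assume Pd ≥ 2. For every unit vector ψ ∈ ℂ^{Pd} ⊗ ℂ^m, the average of ⟨ψ ⊗ ψ, (V(U)†V(U))^{⊗2} S_out (ψ ⊗ ψ)⟩ over μ exceeds the true swap expectation ⟨ψ ⊗ ψ, S_out (ψ ⊗ ψ)⟩ = tr((ψ^out)²) by exactly (P − 1)(P·d − tr((ψ^out)²))/(P²d² − 1), which is at least (P − 1)/(P·d + 1); in particular, when P ≥ 2 the discrepancy is at least 1/(4d). -/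
open MeasureTheory ComplexConjugate
open scoped Matrix

/-- The Borel σ-algebra on the unitary group of complex matrices. -/
noncomputable instance unitaryGroupMeasurableSpace {ι : Type*} [Fintype ι] [DecidableEq ι] :
    MeasurableSpace (Matrix.unitaryGroup ι ℂ) := borel _

instance unitaryGroupBorelSpace {ι : Type*} [Fintype ι] [DecidableEq ι] :
    BorelSpace (Matrix.unitaryGroup ι ℂ) := ⟨rfl⟩

/-- The standard Hermitian inner product `⟨f, g⟩ = ∑ x, conj (f x) * g x`. -/
noncomputable def inn {ι : Type*} [Fintype ι] (f g : ι → ℂ) : ℂ :=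
  ∑ x, conj (f x) * g x

/-- The single-layer slice-normal map
`V(U) = √P (⟨0|_P ⊗ Id_d) U ⊗ Id_m : ℂ^{Pd} ⊗ ℂ^m → ℂ^d ⊗ ℂ^m`, given entrywise by
`(V(U)ψ)(j, y) = √P · ∑ x, U((0, j), x) · ψ(x, y)`. -/
noncomputable def sliceV (P d m : ℕ) (hP : 0 < P)
    (U : Matrix.unitaryGroup (Fin P × Fin d) ℂ)
    (ψ : (Fin P × Fin d) × Fin m → ℂ) : Fin d × Fin m → ℂ :=
  fun jy => (Real.sqrt P : ℂ) *
    ∑ x : Fin P × Fin d,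
      (U : Matrix (Fin P × Fin d) (Fin P × Fin d) ℂ) ((⟨0, hP⟩ : Fin P), jy.1) x * ψ (x, jy.2)

/-- The reduced density matrix of `ψ ∈ ℂ^{Pd} ⊗ ℂ^m` on the out factor `ℂ^m`:
`ψ^out(y, y') = ∑ x, ψ(x, y) · conj (ψ(x, y'))`. -/
noncomputable def outMat (P d m : ℕ) (ψ : (Fin P × Fin d) × Fin m → ℂ) :
    Matrix (Fin m) (Fin m) ℂ :=
  fun y y' => ∑ x : Fin P × Fin d, ψ (x, y) * conj (ψ (x, y'))

/-- The doubled vector `ψ ⊗ ψ` on two copies of `ℂ^{Pd} ⊗ ℂ^m`. -/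
noncomputable def tensSelf (P d m : ℕ) (ψ : (Fin P × Fin d) × Fin m → ℂ) :
    ((Fin P × Fin d) × Fin m) × ((Fin P × Fin d) × Fin m) → ℂ :=
  fun uv => ψ uv.1 * ψ uv.2

/-- The operator `S_out` on `(ℂ^{Pd} ⊗ ℂ^m)^{⊗2}` swapping the two `ℂ^m` factors and
leaving the two `ℂ^{Pd}` factors fixed: `(S Φ)(x₁, y₁, x₂, y₂) = Φ(x₁, y₂, x₂, y₁)`. -/
def swapOut (P d m : ℕ)
    (Φ : ((Fin P × Fin d) × Fin m) × ((Fin P × Fin d) × Fin m) → ℂ) :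
    ((Fin P × Fin d) × Fin m) × ((Fin P × Fin d) × Fin m) → ℂ :=
  fun uv => Φ ((uv.1.1, uv.2.2), (uv.2.1, uv.1.2))

/-- The two-copy slice-normal map `V(U) ⊗ V(U)` acting on the doubled space. -/
noncomputable def sliceV2 (P d m : ℕ) (hP : 0 < P)
    (U : Matrix.unitaryGroup (Fin P × Fin d) ℂ)
    (Φ : ((Fin P × Fin d) × Fin m) × ((Fin P × Fin d) × Fin m) → ℂ) :
    (Fin d × Fin m) × (Fin d × Fin m) → ℂ :=
  fun jk => (P : ℂ) *
    ∑ x₁ : Fin P × Fin d, ∑ x₂ : Fin P × Fin d,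
      (U : Matrix (Fin P × Fin d) (Fin P × Fin d) ℂ) ((⟨0, hP⟩ : Fin P), jk.1.1) x₁ *
        (U : Matrix (Fin P × Fin d) (Fin P × Fin d) ℂ) ((⟨0, hP⟩ : Fin P), jk.2.1) x₂ *
          Φ ((x₁, jk.1.2), (x₂, jk.2.2))

set_option linter.all false

section Helpers

/-- The matrix of the compressed projector. -/
noncomputable def compM {ι κ : Type*} [Fintype ι] [DecidableEq ι] [Fintype κ] (r : κ → ι)
    (U : Matrix.unitaryGroup ι ℂ) (a b : ι) : ℂ :=
  ∑ j, conj ((U : Matrix ι ι ℂ) (r j) a) * (U : Matrix ι ι ℂ) (r j) b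

variable {ι κ : Type*} [Fintype ι] [DecidableEq ι] [Fintype κ] [DecidableEq κ] (r : κ → ι)

lemma continuous_compM (a b : ι) : Continuous (fun U => compM r U a b) := by
  unfold compM
  have h : ∀ i j, Continuous (fun U : Matrix.unitaryGroup ι ℂ => (U : Matrix ι ι ℂ) i j) :=
    fun i j => continuous_subtype_val.matrix_elem i j
  refine continuous_finsetSum _ fun j _ => ?_
  exact (Complex.continuous_conj.comp (h _ _)).mul (h _ _)

lemma norm_compM_le (U : Matrix.unitaryGroup ι ℂ) (a b : ι) :
    ‖compM r U a b‖ ≤ Fintype.card κ := by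
  unfold compM
  refine (norm_sum_le _ _).trans ?_
  have : ∀ j ∈ (Finset.univ : Finset κ),
      ‖conj ((U : Matrix ι ι ℂ) (r j) a) * (U : Matrix ι ι ℂ) (r j) b‖ ≤ 1 := by
    intro j _
    rw [norm_mul, RCLike.norm_conj]
    have h := fun x => entry_norm_bound_of_unitary U.2 (r j) x
    exact mul_le_one₀ (h a) (norm_nonneg _) (h b)
  refine (Finset.sum_le_sum this).trans ?_
  simp

variable (μ : Measure (Matrix.unitaryGroup ι ℂ)) [IsProbabilityMeasure μ]

lemma integrable_compM (a b c e : ι) :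
    Integrable (fun U => compM r U a b * compM r U c e) μ := by
  refine Integrable.of_bound
    ((continuous_compM r a b).mul (continuous_compM r c e)).aestronglyMeasurable
    ((Fintype.card κ : ℝ) * Fintype.card κ) (Filter.Eventually.of_forall fun U => ?_)
  rw [norm_mul]
  exact mul_le_mul (norm_compM_le r U a b) (norm_compM_le r U c e) (norm_nonneg _) (by positivity)

/-- The second moment. -/
noncomputable def momF (a b c e : ι) : ℂ := ∫ U, compM r U a b * compM r U c e ∂μ

lemma momF_comm (a b c e : ι) : momF r μ a b c e = momF r μ c e a b := by
  unfold momF; simp_rw [mul_comm]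

lemma compM_mul (U W : Matrix.unitaryGroup ι ℂ) (a b : ι) :
    compM r (U * W) a b = ∑ a', ∑ b', conj ((W : Matrix ι ι ℂ) a' a) * (W : Matrix ι ι ℂ) b' b
      * compM r U a' b' := by
  unfold compM
  simp only [Submonoid.coe_mul, Matrix.mul_apply, map_sum, map_mul]
  simp only [Finset.sum_mul_sum]
  simp only [Finset.mul_sum]
  rw [Finset.sum_comm]
  refine Finset.sum_congr rfl fun a' _ => ?_
  rw [Finset.sum_comm]
  refine Finset.sum_congr rfl fun b' _ => Finset.sum_congr rfl fun j _ => ?_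
  ring

/-- diagonal unitary -/
noncomputable def diagU (k : ι) : Matrix.unitaryGroup ι ℂ :=
  ⟨Matrix.diagonal (fun i => if i = k then Complex.I else 1), by
    rw [Matrix.mem_unitaryGroup_iff, Matrix.star_eq_conjTranspose, Matrix.diagonal_conjTranspose,
      Matrix.diagonal_mul_diagonal, ← Matrix.diagonal_one]
    congr 1
    funext i
    by_cases h : i = k <;> simp [h]⟩

/-- permutation unitary -/
noncomputable def permU (σ : Equiv.Perm ι) : Matrix.unitaryGroup ι ℂ :=
  ⟨Matrix.of fun i j => if i = σ j then 1 else 0, by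
    rw [Matrix.mem_unitaryGroup_iff']
    ext i j
    simp [Matrix.mul_apply, Matrix.one_apply, Matrix.star_apply, eq_comm]⟩

lemma compM_diag (U : Matrix.unitaryGroup ι ℂ) (k a b : ι) :
    compM r (U * diagU k) a b = conj (if a = k then Complex.I else 1) *
      (if b = k then Complex.I else 1) * compM r U a b := by
  rw [compM_mul]
  rw [Finset.sum_eq_single a, Finset.sum_eq_single b]
  · simp [diagU]
  · intro b' _ h; simp [diagU, h]
  · simp
  · intro b' _ h; simp [diagU, h]
  · simp

lemma compM_perm (U : Matrix.unitaryGroup ι ℂ) (σ : Equiv.Perm ι) (a b : ι) :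
    compM r (U * permU σ) a b = compM r U (σ a) (σ b) := by
  rw [compM_mul]
  rw [Finset.sum_eq_single (σ a), Finset.sum_eq_single (σ b)]
  · simp [permU]
  · intro b' _ h; simp [permU, h]
  · simp
  · intro b' _ h; simp [permU, h]
  · simp

/-- rotation matrix -/
noncomputable def rotM (k l : ι) : Matrix ι ι ℂ := fun i j =>
  if j = k then (if i = k then 3/5 else if i = l then 4/5 else 0)
  else if j = l then (if i = k then -4/5 else if i = l then 3/5 else 0)
  else if i = j then 1 else 0

lemma cj3 : conj (3 : ℂ) = 3 := map_ofNat _ 3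

lemma cj4 : conj (4 : ℂ) = 4 := map_ofNat _ 4

lemma cj5 : conj (5 : ℂ) = 5 := map_ofNat _ 5

lemma sum_two (k l : ι) (hkl : k ≠ l) (f : ι → ℂ) (hf : ∀ i, i ≠ k → i ≠ l → f i = 0) :
    ∑ i, f i = f k + f l := by
  rw [← Finset.sum_subset (Finset.subset_univ {k, l}), Finset.sum_pair hkl]
  intro x _ hx
  simp only [Finset.mem_insert, Finset.mem_singleton, not_or] at hx
  exact hf x hx.1 hx.2

lemma rotM_mem (k l : ι) (hkl : k ≠ l) : rotM k l ∈ Matrix.unitaryGroup ι ℂ := by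
  rw [Matrix.mem_unitaryGroup_iff']
  ext i j
  rw [Matrix.mul_apply]
  have hlk := hkl.symm
  have key : ∀ x, (star (rotM k l)) i x = conj (rotM k l x i) := fun x => rfl
  simp_rw [key]
  by_cases hi : i = k ∨ i = l
  · rw [sum_two k l hkl]
    · rcases hi with rfl | rfl
      · by_cases h1 : j = i
        · subst h1; simp [rotM, cj3, cj4, cj5, hlk]; norm_num
        · by_cases h2 : j = l
          · subst h2; simp [rotM, cj3, cj4, cj5, hlk, Matrix.one_apply, hkl]; norm_num
          · simp [rotM, cj3, cj4, cj5, hlk, Matrix.one_apply, h1, h2, Ne.symm h1, Ne.symm h2]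
      · by_cases h1 : j = i
        · subst h1; simp [rotM, cj3, cj4, cj5, hlk]; norm_num
        · by_cases h2 : j = k
          · subst h2; simp [rotM, cj3, cj4, cj5, hlk, Matrix.one_apply]; norm_num
          · simp [rotM, cj3, cj4, cj5, hlk, Matrix.one_apply, h1, h2, Ne.symm h1, Ne.symm h2]
    · intro x h1 h2
      rcases hi with rfl | rfl <;> simp [rotM, h1, h2]
  · push Not at hi
    rw [Finset.sum_eq_single i]
    · by_cases h1 : j = k
      · subst h1; simp [rotM, Matrix.one_apply, hi.1, hi.2]
      · by_cases h2 : j = l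
        · subst h2; simp [rotM, Matrix.one_apply, hi.1, hi.2]
        · simp [rotM, Matrix.one_apply, hi.1, hi.2, h1, h2]
    · intro x _ hx
      simp [rotM, hi.1, hi.2, hx]
    · simp

lemma compM_rot (U : Matrix.unitaryGroup ι ℂ) (k l : ι) (hkl : k ≠ l) :
    compM r (U * ⟨rotM k l, rotM_mem k l hkl⟩) k k = 9/25 * compM r U k k +
      12/25 * compM r U k l + 12/25 * compM r U l k + 16/25 * compM r U l l := by
  rw [compM_mul]
  have hlk := hkl.symm
  rw [sum_two k l hkl]
  · rw [sum_two k l hkl, sum_two k l hkl]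
    · simp [rotM, cj3, cj4, cj5, hlk]; ring
    · intro i h1 h2; simp [rotM, h1, h2]
    · intro i h1 h2; simp [rotM, h1, h2]
  · intro i h1 h2; simp [rotM, h1, h2]

variable [μ.IsMulRightInvariant]

lemma momF_inv (W : Matrix.unitaryGroup ι ℂ) (a b c e : ι) :
    momF r μ a b c e = ∫ U, compM r (U * W) a b * compM r (U * W) c e ∂μ := by
  unfold momF
  exact (integral_mul_right_eq_self (fun U => compM r U a b * compM r U c e) W).symm

lemma momF_perm (σ : Equiv.Perm ι) (a b c e : ι) :
    momF r μ a b c e = momF r μ (σ a) (σ b) (σ c) (σ e) := by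
  rw [momF_inv r μ (permU σ)]
  simp_rw [compM_perm]
  rfl

lemma momF_diag (k a b c e : ι) :
    momF r μ a b c e = (conj (if a = k then Complex.I else 1) * (if b = k then Complex.I else 1) *
      (conj (if c = k then Complex.I else 1) * (if e = k then Complex.I else 1))) *
        momF r μ a b c e := by
  conv_lhs => rw [momF_inv r μ (diagU k)]
  simp_rw [compM_diag]
  unfold momF
  rw [← integral_const_mul]
  congr 1
  funext U
  ring

lemma self_zero {z x : ℂ} (h : x = z * x) (hz : z ≠ 1) : x = 0 := by
  have : (z - 1) * x = 0 := by linear_combination -h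
  rcases mul_eq_zero.1 this with h | h
  · exact absurd (sub_eq_zero.1 h) hz
  · exact h

lemma momF_zero (a b c e : ι) (h1 : ¬ (a = b ∧ c = e)) (h2 : ¬ (a = e ∧ b = c)) :
    momF r μ a b c e = 0 := by
  have hI : Complex.I ≠ 1 := by intro h; simpa using congrArg Complex.re h
  have hI2 : -Complex.I ≠ 1 := by intro h; simpa using congrArg Complex.re h
  have hn : (-1 : ℂ) ≠ 1 := by norm_num
  by_cases hab : a = b
  · subst hab
    have hce : c ≠ e := fun h => h1 ⟨rfl, h⟩
    refine self_zero (momF_diag r μ c a a c e) ?_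
    have hec := hce.symm
    by_cases hac : a = c <;> simp [hac, hec, hI2]
  · have hba : b ≠ a := fun h => hab h.symm
    by_cases hae : a = e
    · subst hae
      have hbc : b ≠ c := fun h => h2 ⟨rfl, h⟩
      refine self_zero (momF_diag r μ b a b c a) ?_
      simp [hab, hbc.symm, hI]
    · have hea : e ≠ a := fun h => hae h.symm
      refine self_zero (momF_diag r μ a a b c e) ?_
      by_cases hca : c = a <;> simp [hba, hea, hca, hI2, hn]

lemma momF_rot (k l : ι) (hkl : k ≠ l) :
    momF r μ k k k k = 81/625 * momF r μ k k k k + 256/625 * momF r μ l l l l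
      + 144/625 * (momF r μ k k l l + momF r μ l l k k + momF r μ k l l k + momF r μ l k k l) := by
  have hlk := hkl.symm
  have z1 := momF_zero r μ k k k l (by simp [hkl]) (by simp [hkl])
  have z2 := momF_zero r μ k k l k (by simp [hlk]) (by simp [hkl])
  have z3 := momF_zero r μ k l k l (by simp [hkl]) (by simp [hkl])
  have z4 := momF_zero r μ l k l k (by simp [hlk]) (by simp [hlk])
  have z5 := momF_zero r μ l l k l (by simp [hkl]) (by simp [hlk])
  have z6 := momF_zero r μ l l l k (by simp [hlk]) (by simp [hlk])
  have i := integrable_compM r μ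
  conv_lhs => rw [momF_inv r μ ⟨rotM k l, rotM_mem k l hkl⟩]
  simp_rw [compM_rot r _ k l hkl]
  have e : ∀ U, (9/25 * compM r U k k +
      12/25 * compM r U k l + 12/25 * compM r U l k + 16/25 * compM r U l l) *
      (9/25 * compM r U k k +
      12/25 * compM r U k l + 12/25 * compM r U l k + 16/25 * compM r U l l) =
      81/625 * (compM r U k k * compM r U k k) + 256/625 * (compM r U l l * compM r U l l)
      + 144/625 * (compM r U k k * compM r U l l)
      + 144/625 * (compM r U l l * compM r U k k)
      + 144/625 * (compM r U k l * compM r U l k)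
      + 144/625 * (compM r U l k * compM r U k l)
      + 216/625 * (compM r U k k * compM r U k l)
      + 216/625 * (compM r U k k * compM r U l k)
      + 144/625 * (compM r U k l * compM r U k l)
      + 144/625 * (compM r U l k * compM r U l k)
      + 384/625 * (compM r U l l * compM r U k l)
      + 384/625 * (compM r U l l * compM r U l k) := by
    intro U; ring
  simp_rw [e]
  have j := fun (z : ℂ) a b c e => (i a b c e).const_mul z
  have t1 := (j (81/625) k k k k).add (j (256/625) l l l l)
  have t2 := t1.add (j (144/625) k k l l)
  have t3 := t2.add (j (144/625) l l k k)
  have t4 := t3.add (j (144/625) k l l k)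
  have t5 := t4.add (j (144/625) l k k l)
  have t6 := t5.add (j (216/625) k k k l)
  have t7 := t6.add (j (216/625) k k l k)
  have t8 := t7.add (j (144/625) k l k l)
  have t9 := t8.add (j (144/625) l k l k)
  have t10 := t9.add (j (384/625) l l k l)
  erw [integral_add t10 (j _ _ _ _ _), integral_add t9 (j _ _ _ _ _),
    integral_add t8 (j _ _ _ _ _), integral_add t7 (j _ _ _ _ _), integral_add t6 (j _ _ _ _ _),
    integral_add t5 (j _ _ _ _ _), integral_add t4 (j _ _ _ _ _), integral_add t3 (j _ _ _ _ _),
    integral_add t2 (j _ _ _ _ _), integral_add t1 (j _ _ _ _ _),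
    integral_add (j _ _ _ _ _) (j _ _ _ _ _)]
  simp only [integral_const_mul]
  unfold momF at *
  rw [z1, z2, z3, z4, z5, z6]
  ring

lemma exists_perm {a c a' c' : ι} (h : a ≠ c) (h' : a' ≠ c') :
    ∃ σ : Equiv.Perm ι, σ a = a' ∧ σ c = c' := by
  refine ⟨(Equiv.swap a a').trans (Equiv.swap (Equiv.swap a a' c) c'), ?_, ?_⟩
  · simp only [Equiv.trans_apply, Equiv.swap_apply_left]
    apply Equiv.swap_apply_of_ne_of_ne _ h'
    intro h2
    apply h
    have := congrArg (Equiv.swap a a') h2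
    simpa using this
  · simp

lemma momF_form (k l : ι) (hkl : k ≠ l) (a b c e : ι) :
    momF r μ a b c e = momF r μ k k l l * (if a = b ∧ c = e then 1 else 0) +
      momF r μ k l l k * (if a = e ∧ b = c then 1 else 0) := by
  by_cases h1 : a = b ∧ c = e
  · obtain ⟨rfl, rfl⟩ := h1
    by_cases hac : a = c
    · subst hac
      have q1 := momF_rot r μ k l hkl
      have q2 := momF_perm r μ (Equiv.swap k l) l l l l
      have q3 := momF_perm r μ (Equiv.swap a k) a a a a
      have q4 := momF_perm r μ (Equiv.swap k l) l k k l
      have q5 := momF_perm r μ (Equiv.swap k l) l l k k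
      simp only [Equiv.swap_apply_left, Equiv.swap_apply_right] at q2 q3 q4 q5
      rw [q3]
      simp
      rw [q2, q4, q5] at q1
      linear_combination (625/288) * q1
    · obtain ⟨σ, rfl, rfl⟩ := exists_perm hkl hac
      rw [← momF_perm]
      simp [hkl]
  · by_cases h2 : a = e ∧ b = c
    · obtain ⟨rfl, rfl⟩ := h2
      have hab : a ≠ b := fun h => h1 ⟨h, h.symm⟩
      obtain ⟨σ, rfl, rfl⟩ := exists_perm hkl hab
      rw [← momF_perm]
      simp [hkl]
    · rw [momF_zero r μ a b c e h1 h2]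
      simp [h1, h2]

lemma row_orth (U : Matrix.unitaryGroup ι ℂ) (i j : ι) :
    ∑ x, conj ((U : Matrix ι ι ℂ) i x) * (U : Matrix ι ι ℂ) j x = if i = j then 1 else 0 := by
  have h := Matrix.mem_unitaryGroup_iff.1 U.2
  have h2 := congrFun (congrFun h j) i
  rw [Matrix.mul_apply, Matrix.one_apply] at h2
  simp only [eq_comm (a := j)] at h2
  rw [← h2]
  refine Finset.sum_congr rfl fun x _ => ?_
  rw [mul_comm]; rfl

lemma trace_compM (U : Matrix.unitaryGroup ι ℂ) : ∑ a, compM r U a a = Fintype.card κ := by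
  unfold compM
  rw [Finset.sum_comm]
  simp [row_orth]

lemma trace_compM_sq (hr : Function.Injective r) (U : Matrix.unitaryGroup ι ℂ) :
    ∑ a, ∑ c, compM r U a c * compM r U c a = Fintype.card κ := by
  have : ∀ a c, compM r U a c * compM r U c a = ∑ i, ∑ j,
      (conj ((U : Matrix ι ι ℂ) (r i) a) * (U : Matrix ι ι ℂ) (r j) a) *
      (conj ((U : Matrix ι ι ℂ) (r j) c) * (U : Matrix ι ι ℂ) (r i) c) := by
    intro a c
    unfold compM
    rw [Finset.sum_mul_sum]
    refine Finset.sum_congr rfl fun i _ => Finset.sum_congr rfl fun j _ => ?_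
    ring
  simp_rw [this]
  calc _ = ∑ i, ∑ j, (∑ a, conj ((U : Matrix ι ι ℂ) (r i) a) * (U : Matrix ι ι ℂ) (r j) a) *
      (∑ c, conj ((U : Matrix ι ι ℂ) (r j) c) * (U : Matrix ι ι ℂ) (r i) c) := by
        simp_rw [Finset.sum_mul_sum]
        rw [Finset.sum_congr rfl fun a _ => Finset.sum_comm, Finset.sum_comm]
        refine Finset.sum_congr rfl fun i _ => ?_
        rw [Finset.sum_congr rfl fun a _ => Finset.sum_comm, Finset.sum_comm]
    _ = _ := by
        simp [row_orth, hr.eq_iff]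

lemma momF_sum1 : ∑ a, ∑ c, momF r μ a a c c = (Fintype.card κ : ℂ) ^ 2 := by
  unfold momF
  have i := integrable_compM r μ
  simp_rw [← integral_finsetSum _ (fun c _ => i _ _ c c)]
  rw [← integral_finsetSum _ (fun a _ => integrable_finsetSum _ (fun c _ => i a a c c))]
  simp_rw [← Finset.sum_mul_sum, trace_compM]
  simp [sq]

lemma momF_sum2 (hr : Function.Injective r) :
    ∑ a, ∑ c, momF r μ a c c a = (Fintype.card κ : ℂ) := by
  unfold momF
  have i := integrable_compM r μ
  simp_rw [← integral_finsetSum _ (fun c _ => i _ c c _)]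
  rw [← integral_finsetSum _ (fun a _ => integrable_finsetSum _ (fun c _ => i a c c a))]
  simp_rw [trace_compM_sq r hr]
  simp

lemma momF_main (hr : Function.Injective r) (hc : 2 ≤ Fintype.card ι) :
    ∃ B C : ℂ, (∀ a b c e, momF r μ a b c e = B * (if a = b ∧ c = e then 1 else 0) +
      C * (if a = e ∧ b = c then 1 else 0)) ∧
      B * (Fintype.card ι : ℂ) ^ 2 + C * (Fintype.card ι : ℂ) = (Fintype.card κ : ℂ) ^ 2 ∧
      B * (Fintype.card ι : ℂ) + C * (Fintype.card ι : ℂ) ^ 2 = (Fintype.card κ : ℂ) := by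
  obtain ⟨k, l, hkl⟩ := Fintype.one_lt_card_iff.1 hc
  obtain ⟨B, C, F⟩ : ∃ B C : ℂ, ∀ a b c e, momF r μ a b c e =
      B * (if a = b ∧ c = e then 1 else 0) + C * (if a = e ∧ b = c then 1 else 0) :=
    ⟨_, _, momF_form r μ k l hkl⟩
  refine ⟨B, C, F, ?_, ?_⟩
  · rw [← momF_sum1 r μ]
    simp_rw [F]
    have : ∀ a c : ι, (a = c ∧ a = c) ↔ a = c := by simp
    simp [Finset.sum_add_distrib, this]
    ring
  · rw [← momF_sum2 r μ hr]
    simp_rw [F]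
    have : ∀ a c : ι, (a = c ∧ c = a) ↔ a = c := by
      intro a c; constructor
      · exact fun h => h.1
      · exact fun h => ⟨h, h.symm⟩
    simp [Finset.sum_add_distrib, this]
    ring

end Helpers

lemma integrand_eq (P d m : ℕ) (hP : 0 < P) (ψ : (Fin P × Fin d) × Fin m → ℂ)
    (U : Matrix.unitaryGroup (Fin P × Fin d) ℂ) :
    inn (sliceV2 P d m hP U (tensSelf P d m ψ))
             (sliceV2 P d m hP U (swapOut P d m (tensSelf P d m ψ))) =
    ∑ y₁, ∑ y₂, ∑ x₁, ∑ x₂, ∑ x₃, ∑ x₄, ((P : ℂ) ^ 2 * (conj (ψ (x₁, y₁)) * conj (ψ (x₂, y₂)) *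
      ψ (x₃, y₂) * ψ (x₄, y₁))) *
      (compM (fun j : Fin d => ((⟨0, hP⟩ : Fin P), j)) U x₁ x₃ *
       compM (fun j : Fin d => ((⟨0, hP⟩ : Fin P), j)) U x₂ x₄) := by
  unfold inn sliceV2 tensSelf swapOut compM
  simp only [Fintype.sum_prod_type (α₁ := Fin d × Fin m), Fintype.sum_prod_type (α₁ := Fin d)]
  rw [Finset.sum_comm]
  refine Finset.sum_congr rfl fun y₁ _ => ?_
  rw [Finset.sum_congr rfl fun j _ => Finset.sum_comm, Finset.sum_comm]
  refine Finset.sum_congr rfl fun y₂ _ => ?_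
  simp only [map_mul, map_sum, Finset.mul_sum, Finset.sum_mul, Complex.conj_natCast]
  simp only [← Finset.sum_product', Finset.univ_product_univ]
  refine Fintype.sum_equiv ⟨fun a => (a.2.2.2.2.1, a.2.2.2.2.2, a.2.2.1, a.2.2.2.1, a.2.1, a.1),
    fun a => (a.2.2.2.2.2, a.2.2.2.2.1, a.2.2.1, a.2.2.2.1, a.1, a.2.1),
    fun _ => rfl, fun _ => rfl⟩ _ _ ?_
  intro a
  simp only [Equiv.coe_fn_mk]
  ring

lemma exp_trace (P d m : ℕ) (ψ : (Fin P × Fin d) × Fin m → ℂ) :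
    ∑ y₁, ∑ y₂, ∑ x₁, ∑ x₂, (conj (ψ (x₁, y₁)) * conj (ψ (x₂, y₂)) * ψ (x₁, y₂) * ψ (x₂, y₁))
      = (outMat P d m ψ * outMat P d m ψ).trace := by
  have ho : ∀ y y', outMat P d m ψ y y' = ∑ x, ψ (x, y) * conj (ψ (x, y')) := fun _ _ => rfl
  simp only [Matrix.trace, Matrix.diag, Matrix.mul_apply, ho, Finset.sum_mul_sum]
  refine Finset.sum_congr rfl fun y₁ _ => Finset.sum_congr rfl fun y₂ _ => ?_
  rw [Finset.sum_comm]
  refine Finset.sum_congr rfl fun x₁ _ => Finset.sum_congr rfl fun x₂ _ => ?_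
  ring

lemma exp_one (P d m : ℕ) (ψ : (Fin P × Fin d) × Fin m → ℂ) (hψ : inn ψ ψ = 1) :
    ∑ y₁, ∑ y₂, ∑ x₁, ∑ x₂, (conj (ψ (x₁, y₁)) * conj (ψ (x₂, y₂)) * ψ (x₂, y₂) * ψ (x₁, y₁))
      = 1 := by
  unfold inn at hψ
  rw [Fintype.sum_prod_type, Finset.sum_comm] at hψ
  calc _ = (∑ y, ∑ x, conj (ψ (x, y)) * ψ (x, y)) * (∑ y, ∑ x, conj (ψ (x, y)) * ψ (x, y)) := by
        simp only [Finset.sum_mul_sum]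
        refine Finset.sum_congr rfl fun y₁ _ => Finset.sum_congr rfl fun y₂ _ =>
          Finset.sum_congr rfl fun x₁ _ => Finset.sum_congr rfl fun x₂ _ => ?_
        ring
    _ = 1 := by rw [hψ, one_mul]

lemma true_swap (P d m : ℕ) (ψ : (Fin P × Fin d) × Fin m → ℂ) :
    inn (tensSelf P d m ψ) (swapOut P d m (tensSelf P d m ψ))
        = (outMat P d m ψ * outMat P d m ψ).trace := by
  rw [← exp_trace]
  unfold inn tensSelf swapOut
  simp only [Fintype.sum_prod_type (α₂ := Fin m),
    Fintype.sum_prod_type (α₁ := (Fin P × Fin d) × Fin m)]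
  rw [Finset.sum_comm]
  refine Finset.sum_congr rfl fun y₁ _ => ?_
  rw [Finset.sum_congr rfl fun j _ => Finset.sum_comm, Finset.sum_comm]
  refine Finset.sum_congr rfl fun y₂ _ => Finset.sum_congr rfl fun x₁ _ =>
    Finset.sum_congr rfl fun x₂ _ => ?_
  rw [map_mul]; ring

lemma trace_le (P d m : ℕ) (ψ : (Fin P × Fin d) × Fin m → ℂ) (hψ : inn ψ ψ = 1) :
    (outMat P d m ψ * outMat P d m ψ).trace.re ≤ 1 := by
  have h1 : ∑ y, ∑ x, ‖ψ (x, y)‖ ^ 2 = 1 := by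
    unfold inn at hψ
    rw [Fintype.sum_prod_type, Finset.sum_comm] at hψ
    simp only [Complex.conj_mul'] at hψ
    exact_mod_cast hψ
  have h2 : (outMat P d m ψ * outMat P d m ψ).trace.re ≤
      ∑ y₁, ∑ y₂, (∑ x, ‖ψ (x, y₁)‖ ^ 2) * (∑ x, ‖ψ (x, y₂)‖ ^ 2) := by
    simp only [Matrix.trace, Matrix.diag, Matrix.mul_apply, Complex.re_sum]
    refine Finset.sum_le_sum fun y₁ _ => Finset.sum_le_sum fun y₂ _ => ?_
    refine (Complex.re_le_norm _).trans ?_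
    rw [norm_mul]
    have b : ∀ y y', ‖outMat P d m ψ y y'‖ ≤ ∑ x, ‖ψ (x, y)‖ * ‖ψ (x, y')‖ := by
      intro y y'
      unfold outMat
      refine (norm_sum_le _ _).trans (le_of_eq ?_)
      simp
    have b2 := b y₂ y₁
    simp_rw [mul_comm ‖ψ (_, y₂)‖] at b2
    refine (mul_le_mul (b y₁ y₂) b2 (norm_nonneg _) (by positivity)).trans ?_
    rw [← sq]
    exact Finset.sum_mul_sq_le_sq_mul_sq _ _ _
  rw [← Finset.sum_mul_sum, h1] at h2
  simpa using h2

lemma integral_eq (P d m : ℕ) (hP : 0 < P) (hPd : 2 ≤ P * d)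
    (μ : Measure (Matrix.unitaryGroup (Fin P × Fin d) ℂ))
    [IsProbabilityMeasure μ] [μ.IsMulRightInvariant]
    (ψ : (Fin P × Fin d) × Fin m → ℂ) (hψ : inn ψ ψ = 1) :
    ∃ B C : ℂ, (∫ U, inn (sliceV2 P d m hP U (tensSelf P d m ψ))
             (sliceV2 P d m hP U (swapOut P d m (tensSelf P d m ψ))) ∂μ) =
        (P : ℂ) ^ 2 * (B * (outMat P d m ψ * outMat P d m ψ).trace + C) ∧
      B * ((P : ℂ) * d) ^ 2 + C * ((P : ℂ) * d) = (d : ℂ) ^ 2 ∧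
      B * ((P : ℂ) * d) + C * ((P : ℂ) * d) ^ 2 = (d : ℂ) := by
  obtain ⟨B, C, hF, h1, h2⟩ := momF_main (fun j : Fin d => ((⟨0, hP⟩ : Fin P), j)) μ
    (fun a b h => by simpa using h) (by simpa using hPd)
  simp only [Fintype.card_prod, Fintype.card_fin, Nat.cast_mul] at h1 h2
  refine ⟨B, C, ?_, h1, h2⟩
  simp_rw [integrand_eq]
  have i := integrable_compM (fun j : Fin d => ((⟨0, hP⟩ : Fin P), j)) μ
  have j := fun (z : ℂ) a b c e => (i a b c e).const_mul z
  have k : ∀ z a b c e, ∫ U, z * (compM (fun j : Fin d => ((⟨0, hP⟩ : Fin P), j)) U a b *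
      compM (fun j : Fin d => ((⟨0, hP⟩ : Fin P), j)) U c e) ∂μ =
      z * (B * (if a = b ∧ c = e then 1 else 0) + C * (if a = e ∧ b = c then 1 else 0)) := by
    intro z a b c e
    rw [integral_const_mul, ← hF]; rfl
  have : (∫ U, ∑ y₁, ∑ y₂, ∑ x₁, ∑ x₂, ∑ x₃, ∑ x₄, ((P : ℂ) ^ 2 * (conj (ψ (x₁, y₁)) *
      conj (ψ (x₂, y₂)) * ψ (x₃, y₂) * ψ (x₄, y₁))) *
      (compM (fun j : Fin d => ((⟨0, hP⟩ : Fin P), j)) U x₁ x₃ *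
       compM (fun j : Fin d => ((⟨0, hP⟩ : Fin P), j)) U x₂ x₄) ∂μ) =
      ∑ y₁, ∑ y₂, ∑ x₁, ∑ x₂, ∑ x₃, ∑ x₄, ((P : ℂ) ^ 2 * (conj (ψ (x₁, y₁)) *
      conj (ψ (x₂, y₂)) * ψ (x₃, y₂) * ψ (x₄, y₁))) *
      (B * (if x₁ = x₃ ∧ x₂ = x₄ then 1 else 0) + C * (if x₁ = x₄ ∧ x₃ = x₂ then 1 else 0)) := by
    rw [integral_finsetSum _ fun y₁ _ => ?_]
    · refine Finset.sum_congr rfl fun y₁ _ => ?_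
      rw [integral_finsetSum _ fun y₂ _ => ?_]
      · refine Finset.sum_congr rfl fun y₂ _ => ?_
        rw [integral_finsetSum _ fun x₁ _ => ?_]
        · refine Finset.sum_congr rfl fun x₁ _ => ?_
          rw [integral_finsetSum _ fun x₂ _ => ?_]
          · refine Finset.sum_congr rfl fun x₂ _ => ?_
            rw [integral_finsetSum _ fun x₃ _ => ?_]
            · refine Finset.sum_congr rfl fun x₃ _ => ?_
              rw [integral_finsetSum _ fun x₄ _ => ?_]
              · exact Finset.sum_congr rfl fun x₄ _ => k _ _ _ _ _
              · exact j _ _ _ _ _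
            · exact integrable_finsetSum _ fun _ _ => j _ _ _ _ _
          · exact integrable_finsetSum _ fun _ _ => integrable_finsetSum _ fun _ _ => j _ _ _ _ _
        · exact integrable_finsetSum _ fun _ _ => integrable_finsetSum _ fun _ _ =>
            integrable_finsetSum _ fun _ _ => j _ _ _ _ _
      · exact integrable_finsetSum _ fun _ _ => integrable_finsetSum _ fun _ _ =>
            integrable_finsetSum _ fun _ _ => integrable_finsetSum _ fun _ _ => j _ _ _ _ _
    · exact integrable_finsetSum _ fun _ _ => integrable_finsetSum _ fun _ _ =>
            integrable_finsetSum _ fun _ _ => integrable_finsetSum _ fun _ _ =>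
            integrable_finsetSum _ fun _ _ => j _ _ _ _ _
  rw [this]
  have inner : ∀ y₁ y₂ x₁ x₂, ∑ x₃, ∑ x₄, ((P : ℂ) ^ 2 * (conj (ψ (x₁, y₁)) *
      conj (ψ (x₂, y₂)) * ψ (x₃, y₂) * ψ (x₄, y₁))) *
      (B * (if x₁ = x₃ ∧ x₂ = x₄ then 1 else 0) + C * (if x₁ = x₄ ∧ x₃ = x₂ then 1 else 0)) =
      ((P : ℂ) ^ 2 * B) * (conj (ψ (x₁, y₁)) * conj (ψ (x₂, y₂)) * ψ (x₁, y₂) * ψ (x₂, y₁)) +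
      ((P : ℂ) ^ 2 * C) * (conj (ψ (x₁, y₁)) * conj (ψ (x₂, y₂)) * ψ (x₂, y₂) * ψ (x₁, y₁)) := by
    intro y₁ y₂ x₁ x₂
    simp only [mul_add, Finset.sum_add_distrib]
    congr 1
    · rw [Finset.sum_eq_single x₁, Finset.sum_eq_single x₂]
      · simp; ring
      · intro b _ h; simp [h.symm]
      · simp
      · intro b _ h; simp [h.symm]
      · simp
    · rw [Finset.sum_eq_single x₂, Finset.sum_eq_single x₁]
      · simp; ring
      · intro b _ h; simp [h.symm]
      · simp
      · intro b _ h; simp [h]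
      · simp
  simp_rw [inner, Finset.sum_add_distrib, ← Finset.mul_sum]
  rw [exp_trace, exp_one P d m ψ hψ]
  ring

/-- **Swap-test overlaps are not preserved below an evanescent surface.**  Assume `Pd ≥ 2`.
For every unit vector `ψ ∈ ℂ^{Pd} ⊗ ℂ^m`: the true swap expectation is
`⟨ψ ⊗ ψ, S_out (ψ ⊗ ψ)⟩ = tr((ψ^out)²)`; the Haar average of
`⟨ψ ⊗ ψ, (V(U)†V(U))^{⊗2} S_out (ψ ⊗ ψ)⟩` exceeds it by exactly
`(P − 1)(P·d − tr((ψ^out)²))/(P²d² − 1)`; this discrepancy is at least `(P − 1)/(P·d + 1)`;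
and when `P ≥ 2` it is at least `1/(4d)`.  Here `μ` is the Haar probability measure (the
left- and right-invariant Borel probability measure) on `U(Pd)`. -/
theorem sliceV_swap_test_discrepancy (P d m : ℕ) (hP : 0 < P) (hd : 0 < d) (hm : 0 < m)
    (hPd : 2 ≤ P * d)
    (μ : Measure (Matrix.unitaryGroup (Fin P × Fin d) ℂ))
    [IsProbabilityMeasure μ] [μ.IsMulLeftInvariant] [μ.IsMulRightInvariant]
    (ψ : (Fin P × Fin d) × Fin m → ℂ) (hψ : inn ψ ψ = 1) :
    inn (tensSelf P d m ψ) (swapOut P d m (tensSelf P d m ψ))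
        = (outMat P d m ψ * outMat P d m ψ).trace
    ∧ (∫ U, inn (sliceV2 P d m hP U (tensSelf P d m ψ))
             (sliceV2 P d m hP U (swapOut P d m (tensSelf P d m ψ))) ∂μ)
          - (outMat P d m ψ * outMat P d m ψ).trace
        = ((P : ℂ) - 1) *
            ((P : ℂ) * (d : ℂ) - (outMat P d m ψ * outMat P d m ψ).trace) /
              ((P : ℂ) ^ 2 * (d : ℂ) ^ 2 - 1)
    ∧ ((P : ℝ) - 1) / ((P : ℝ) * (d : ℝ) + 1)
        ≤ ((P : ℝ) - 1) *
            ((P : ℝ) * (d : ℝ) - (outMat P d m ψ * outMat P d m ψ).trace.re) /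
              ((P : ℝ) ^ 2 * (d : ℝ) ^ 2 - 1)
    ∧ (2 ≤ P →
        1 / (4 * (d : ℝ))
          ≤ ((P : ℝ) - 1) *
              ((P : ℝ) * (d : ℝ) - (outMat P d m ψ * outMat P d m ψ).trace.re) /
                ((P : ℝ) ^ 2 * (d : ℝ) ^ 2 - 1)) := by
  have hPd' : (2 : ℝ) ≤ (P : ℝ) * d := by exact_mod_cast hPd
  have hP1 : (1 : ℝ) ≤ P := by exact_mod_cast hP
  have hd1 : (1 : ℝ) ≤ d := by exact_mod_cast hd
  have ht := trace_le P d m ψ hψ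
  have key : ((P : ℝ) - 1) / ((P : ℝ) * (d : ℝ) + 1)
        ≤ ((P : ℝ) - 1) *
            ((P : ℝ) * (d : ℝ) - (outMat P d m ψ * outMat P d m ψ).trace.re) /
              ((P : ℝ) ^ 2 * (d : ℝ) ^ 2 - 1) := by
    have e : (P : ℝ) ^ 2 * (d : ℝ) ^ 2 - 1 = ((P : ℝ) * d + 1) * ((P : ℝ) * d - 1) := by ring
    rw [e, div_le_div_iff₀ (by linarith) (mul_pos (by linarith) (by linarith))]
    have : 0 ≤ ((P : ℝ) - 1) * ((P : ℝ) * d + 1) *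
      (1 - (outMat P d m ψ * outMat P d m ψ).trace.re) :=
      mul_nonneg (mul_nonneg (by linarith) (by linarith)) (by linarith)
    linarith
  refine ⟨true_swap P d m ψ, ?_, key, fun h2 => le_trans ?_ key⟩
  · obtain ⟨B, C, hI, h1, h2⟩ := integral_eq P d m hP hPd μ ψ hψ
    rw [hI]
    generalize (outMat P d m ψ * outMat P d m ψ).trace = t
    have hd0 : (d : ℂ) ≠ 0 := by exact_mod_cast hd.ne'
    have hP0 : (P : ℂ) ≠ 0 := by exact_mod_cast hP.ne'
    have hD : (P : ℂ) ^ 2 * (d : ℂ) ^ 2 - 1 ≠ 0 := by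
      have : (P : ℝ) ^ 2 * (d : ℝ) ^ 2 - 1 ≠ 0 := by nlinarith
      exact_mod_cast this
    rw [eq_div_iff hD]
    have hB : (P : ℂ) ^ 2 * B * ((P : ℂ) ^ 2 * (d : ℂ) ^ 2 - 1) = (P : ℂ) ^ 2 * (d : ℂ) ^ 2 - P := by
      apply mul_right_cancel₀ hd0
      apply mul_right_cancel₀ hd0
      linear_combination ((P : ℂ) * d) ^ 2 * h1 - ((P : ℂ) * d) * h2
    have hC : (P : ℂ) ^ 2 * C * ((P : ℂ) ^ 2 * (d : ℂ) ^ 2 - 1) = (P : ℂ) * (P * d) - P * d := by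
      apply mul_right_cancel₀ hd0
      apply mul_right_cancel₀ hd0
      linear_combination ((P : ℂ) * d) ^ 2 * h2 - ((P : ℂ) * d) * h1
    linear_combination t * hB + hC
  · have hP2 : (2 : ℝ) ≤ P := by exact_mod_cast h2
    rw [div_le_div_iff₀ (by linarith) (by linarith)]
    nlinarith
end

section
/- Master second-moment operator identity: assume Pd ≥ 2. Then ∫ (V(U)†V(U)) ⊗ (V(U)†V(U)) dμ(U) = [P(P·d² − 1)/(P²d² − 1)] · Id + [P·d(P − 1)/(P²d² − 1)] · F_in, as operators on (ℂ^{Pd} ⊗ ℂ^m) ⊗ (ℂ^{Pd} ⊗ ℂ^m), where F_in is the operator swapping the two ℂ^{Pd} factors and leaving the two ℂ^m factors fixed. -/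
open MeasureTheory ComplexConjugate
open scoped Matrix Kronecker

attribute [local instance] Matrix.normedAddCommGroup Matrix.normedSpace

/-- The matrix of the single-layer slice-normal map
`V(U) = √P (⟨0|_P ⊗ Id_d) U ⊗ Id_m : ℂ^{Pd} ⊗ ℂ^m → ℂ^d ⊗ ℂ^m`, given entrywise by
`(V(U)ψ)(j, y) = √P · ∑ x, U((0, j), x) · ψ(x, y)`. -/
noncomputable def sliceVMatrix (P d m : ℕ) (hP : 0 < P)
    (U : Matrix.unitaryGroup (Fin P × Fin d) ℂ) :
    Matrix (Fin d × Fin m) ((Fin P × Fin d) × Fin m) ℂ :=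
  fun jy xz =>
    if jy.2 = xz.2 then
      (Real.sqrt P : ℂ) *
        (U : Matrix (Fin P × Fin d) (Fin P × Fin d) ℂ) ((⟨0, hP⟩ : Fin P), jy.1) xz.1
    else 0

/-- The operator `F_in` on `(ℂ^{Pd} ⊗ ℂ^m) ⊗ (ℂ^{Pd} ⊗ ℂ^m)` swapping the two `ℂ^{Pd}`
factors and leaving the two `ℂ^m` factors fixed, as a matrix. -/
def swapInMatrix (P d m : ℕ) :
    Matrix ((((Fin P × Fin d) × Fin m)) × (((Fin P × Fin d) × Fin m)))
      ((((Fin P × Fin d) × Fin m)) × (((Fin P × Fin d) × Fin m))) ℂ :=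
  fun p q =>
    if p.1.1 = q.2.1 ∧ p.2.1 = q.1.1 ∧ p.1.2 = q.1.2 ∧ p.2.2 = q.2.2 then 1 else 0
section helpers
set_option linter.unusedSectionVars false
set_option linter.unusedSimpArgs false
variable {ι κ : Type*} [Fintype ι] [DecidableEq ι] [Fintype κ] [DecidableEq κ]

noncomputable def hB (r : κ → ι) (U : Matrix.unitaryGroup ι ℂ) : Matrix κ ι ℂ :=
  (U : Matrix ι ι ℂ).submatrix r id

noncomputable def hG (r : κ → ι) (U : Matrix.unitaryGroup ι ℂ) : Matrix ι ι ℂ :=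
  (hB r U)ᴴ * hB r U

lemma hB_mul (r : κ → ι) (hr : Function.Injective r) (U : Matrix.unitaryGroup ι ℂ) :
    hB r U * (hB r U)ᴴ = 1 := by
  have h : (U : Matrix ι ι ℂ) * (U : Matrix ι ι ℂ)ᴴ = 1 := Matrix.mem_unitaryGroup_iff.1 U.2
  unfold hB
  rw [Matrix.conjTranspose_submatrix, ← Matrix.submatrix_mul _ _ _ _ _ Function.bijective_id, h,
    Matrix.submatrix_one _ hr]

lemma hG_trace (r : κ → ι) (hr : Function.Injective r) (U : Matrix.unitaryGroup ι ℂ) :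
    (hG r U).trace = Fintype.card κ := by
  rw [hG, Matrix.trace_mul_comm, hB_mul r hr, Matrix.trace_one]

lemma hG_sq (r : κ → ι) (hr : Function.Injective r) (U : Matrix.unitaryGroup ι ℂ) :
    hG r U * hG r U = hG r U := by
  unfold hG
  rw [Matrix.mul_assoc, ← Matrix.mul_assoc (hB r U), hB_mul r hr, Matrix.one_mul]

lemma hG_mul (r : κ → ι) (U W : Matrix.unitaryGroup ι ℂ) :
    hG r (U * W) = (W : Matrix ι ι ℂ)ᴴ * hG r U * (W : Matrix ι ι ℂ) := by
  have : hB r (U * W) = hB r U * (W : Matrix ι ι ℂ) := by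
    ext i j
    simp [hB, Matrix.mul_apply]
  simp only [hG, this, Matrix.conjTranspose_mul, Matrix.mul_assoc]

lemma hG_cont (r : κ → ι) (x y : ι) : Continuous fun U => hG r U x y := by
  simp only [hG, hB, Matrix.mul_apply, Matrix.conjTranspose_apply, Matrix.submatrix_apply, id]
  have : ∀ a b, Continuous fun U : Matrix.unitaryGroup ι ℂ => (U : Matrix ι ι ℂ) a b :=
    fun a b => (continuous_apply_apply a b).comp continuous_subtype_val
  refine continuous_finsetSum _ fun i _ => ?_
  exact (continuous_star.comp (this _ _)).mul (this _ _)

lemma hG_bound (r : κ → ι) (x y : ι) (U : Matrix.unitaryGroup ι ℂ) :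
    ‖hG r U x y‖ ≤ Fintype.card κ := by
  simp only [hG, hB, Matrix.mul_apply, Matrix.conjTranspose_apply, Matrix.submatrix_apply, id]
  refine (norm_sum_le _ _).trans ?_
  calc _ ≤ ∑ i : κ, (1:ℝ) := Finset.sum_le_sum fun i _ => ?_
    _ = _ := by simp
  rw [norm_mul, norm_star]
  exact mul_le_one₀ (entry_norm_bound_of_unitary U.2 _ _) (norm_nonneg _)
    (entry_norm_bound_of_unitary U.2 _ _)

variable (μ : Measure (Matrix.unitaryGroup ι ℂ)) [IsProbabilityMeasure μ]

lemma hG_int (r : κ → ι) (x y z w : ι) : Integrable (fun U => hG r U x y * hG r U z w) μ := by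
  refine Integrable.of_bound ((hG_cont r x y).mul (hG_cont r z w)).aestronglyMeasurable
    ((Fintype.card κ : ℝ) * Fintype.card κ) (Filter.Eventually.of_forall fun U => ?_)
  rw [norm_mul]
  exact mul_le_mul (hG_bound r x y U) (hG_bound r z w U) (norm_nonneg _) (by positivity)

noncomputable def hT (r : κ → ι) (x y z w : ι) : ℂ := ∫ U, hG r U x y * hG r U z w ∂μ

lemma hT_tr (r : κ → ι) (hr : Function.Injective r) :
    ∑ x, ∑ z, hT μ r x x z z = (Fintype.card κ : ℂ) ^ 2 := by
  simp only [hT]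
  simp_rw [← integral_finsetSum _ fun i _ => hG_int μ r _ _ i i]
  rw [← integral_finsetSum _ fun i _ => integrable_finsetSum _ fun j _ => hG_int μ r _ _ _ _]
  have : ∀ U, ∑ x, ∑ z, hG r U x x * hG r U z z = (Fintype.card κ : ℂ) ^ 2 := by
    intro U
    rw [← Finset.sum_mul_sum, sq, ← hG_trace r hr U]; rfl
  simp [this]

lemma hT_tr2 (r : κ → ι) (hr : Function.Injective r) :
    ∑ x, ∑ z, hT μ r x z z x = (Fintype.card κ : ℂ) := by
  simp only [hT]
  simp_rw [← integral_finsetSum Finset.univ fun i _ => hG_int μ r _ i i _]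
  rw [← integral_finsetSum _ fun i _ => integrable_finsetSum _ fun j _ => hG_int μ r _ _ _ _]
  have : ∀ U, ∑ x, ∑ z, hG r U x z * hG r U z x = (Fintype.card κ : ℂ) := by
    intro U
    rw [← hG_trace r hr U]
    nth_rw 3 [← hG_sq r hr U]
    rfl
  simp [this]

variable [μ.IsMulRightInvariant]

lemma hT_inv (r : κ → ι) (W : Matrix.unitaryGroup ι ℂ) (x y z w : ι) :
    ∫ U, ((W : Matrix ι ι ℂ)ᴴ * hG r U * (W : Matrix ι ι ℂ)) x y *
      ((W : Matrix ι ι ℂ)ᴴ * hG r U * (W : Matrix ι ι ℂ)) z w ∂μ = hT μ r x y z w := by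
  simp_rw [← hG_mul]
  exact integral_mul_right_eq_self (fun U => hG r U x y * hG r U z w) W

lemma hT_diag (r : κ → ι) (v : ι → ℂ) (hv : ∀ i, star (v i) * v i = 1) (x y z w : ι) :
    (star (v x) * v y * star (v z) * v w) * hT μ r x y z w = hT μ r x y z w := by
  have hW : Matrix.diagonal v ∈ Matrix.unitaryGroup ι ℂ := by
    rw [Matrix.mem_unitaryGroup_iff', Matrix.star_eq_conjTranspose, Matrix.diagonal_conjTranspose,
      Matrix.diagonal_mul_diagonal]
    ext i j
    by_cases h : i = j
    · subst h; simpa using hv i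
    · simp [h]
  have := hT_inv μ r ⟨_, hW⟩ x y z w
  simp only [Matrix.diagonal_conjTranspose, Matrix.diagonal_mul, Matrix.mul_diagonal,
    Pi.star_apply] at this
  refine Eq.trans ?_ this
  unfold hT
  rw [← integral_const_mul]
  congr 1; ext U; ring

lemma hT_zero (r : κ → ι) (x y z w : ι) (h1 : ¬ (x = y ∧ z = w)) (h2 : ¬ (x = w ∧ y = z)) :
    hT μ r x y z w = 0 := by
  by_contra hne
  have key : ∀ k : ι, star (if x = k then Complex.I else 1) * (if y = k then Complex.I else 1) *
      star (if z = k then Complex.I else 1) * (if w = k then Complex.I else 1) = 1 := by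
    intro k
    have := hT_diag μ r (fun i => if i = k then Complex.I else 1)
      (by intro i; by_cases h : i = k <;> simp [h]) x y z w
    exact mul_right_cancel₀ hne (by simpa using this)
  have nI : Complex.I ≠ 1 := fun h => by simpa using congrArg Complex.re h
  have nI' : -Complex.I ≠ 1 := fun h => by simpa using congrArg Complex.re h
  have n1 : (-1 : ℂ) ≠ 1 := by norm_num
  by_cases a : x = y
  · subst a
    have b : z ≠ w := fun b => h1 ⟨rfl, b⟩
    have kw := key w
    by_cases c : x = w <;> simp [b, c, nI] at kw
  · have kx := key x
    by_cases c : w = x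
    · subst c
      have e : z ≠ y := fun e => h2 ⟨rfl, e.symm⟩
      have ky := key y
      simp [a, e, nI] at ky
    · have a' : y ≠ x := fun h => a h.symm
      by_cases f : z = x <;> simp [a', c, f, nI', n1] at kx

lemma hT_perm (r : κ → ι) (σ : Equiv.Perm ι) (x y z w : ι) :
    hT μ r (σ x) (σ y) (σ z) (σ w) = hT μ r x y z w := by
  have hW : (Matrix.of fun i j => if i = σ j then (1:ℂ) else 0) ∈ Matrix.unitaryGroup ι ℂ := by
    rw [Matrix.mem_unitaryGroup_iff']
    ext i j
    simp [Matrix.mul_apply, Matrix.star_apply, Matrix.one_apply, apply_ite]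
    try simp [eq_comm]
  rw [← hT_inv μ r ⟨_, hW⟩ x y z w]
  simp [hT, Matrix.mul_apply, apply_ite]

lemma exists_perm2 {x z x' z' : ι} (h : x ≠ z) (h' : x' ≠ z') :
    ∃ σ : Equiv.Perm ι, σ x = x' ∧ σ z = z' := by
  refine ⟨Equiv.swap (Equiv.swap x x' z) z' * Equiv.swap x x', ?_, ?_⟩
  · have : x' ≠ Equiv.swap x x' z := by
      intro e
      apply h
      apply (Equiv.swap x x').injective
      rw [← e]; simp
    simp [Equiv.swap_apply_of_ne_of_ne this h']
  · simp

lemma hT_multi {α : Type*} [Fintype α] (r : κ → ι) (c : α → ℂ) (f g : α → ι) :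
    ∫ U, (∑ p, c p * hG r U (f p) (g p)) * (∑ p, c p * hG r U (f p) (g p)) ∂μ =
      ∑ p, ∑ q, (c p * c q) * hT μ r (f p) (g p) (f q) (g q) := by
  have : ∀ p q, (c p * c q) * hT μ r (f p) (g p) (f q) (g q) =
      ∫ U, (c p * c q) * (hG r U (f p) (g p) * hG r U (f q) (g q)) ∂μ := by
    intro p q
    rw [integral_const_mul]; rfl
  simp_rw [this]
  simp_rw [← integral_finsetSum Finset.univ
    fun i _ => (hG_int μ r _ _ (f i) (g i)).const_mul (c _ * c i)]
  rw [← integral_finsetSum _ fun i _ => integrable_finsetSum _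
    fun j _ => (hG_int μ r _ _ _ _).const_mul _]
  congr 1; ext U
  rw [Finset.sum_mul_sum]
  refine Finset.sum_congr rfl fun p _ => Finset.sum_congr rfl fun q _ => ?_
  ring

lemma hT_had (r : κ → ι) (x z : ι) (h : x ≠ z) :
    hT μ r x x x x = hT μ r x x z z + hT μ r x z z x := by
  have h' : z ≠ x := h.symm
  have c3 : (starRingEnd ℂ) 3 = 3 := Complex.conj_ofNat 3
  have c4 : (starRingEnd ℂ) 4 = 4 := Complex.conj_ofNat 4
  have c5 : (starRingEnd ℂ) 5 = 5 := Complex.conj_ofNat 5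
  have hW : (Matrix.of fun i j => if j = x then
        ((if i = x then (3/5:ℂ) else 0) + (if i = z then (4/5:ℂ) else 0))
      else if j = z then ((if i = x then (-4/5:ℂ) else 0) + (if i = z then (3/5:ℂ) else 0))
      else if i = j then 1 else 0) ∈ Matrix.unitaryGroup ι ℂ := by
    rw [Matrix.mem_unitaryGroup_iff']
    ext i j
    simp only [Matrix.mul_apply, Matrix.star_apply, Matrix.one_apply, Matrix.of_apply]
    by_cases hi : i = x
    · subst hi
      by_cases hj : j = i
      · subst hj
        simp [h, h', add_mul, Finset.sum_add_distrib, apply_ite (starRingEnd ℂ), c3, c4, c5]; norm_num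
      · by_cases hj2 : j = z
        · subst hj2
          simp [h, h', add_mul, Finset.sum_add_distrib, apply_ite (starRingEnd ℂ), c3, c4, c5]; norm_num
        · simp [h, h', hj, hj2, Ne.symm hj, Ne.symm hj2, add_mul, Finset.sum_add_distrib, apply_ite (starRingEnd ℂ)]
    · by_cases hi2 : i = z
      · subst hi2
        by_cases hj : j = x
        · subst hj
          simp [h, h', add_mul, Finset.sum_add_distrib, apply_ite (starRingEnd ℂ), c3, c4, c5]; norm_num
        · by_cases hj2 : j = i
          · subst hj2
            simp [h, h', add_mul, Finset.sum_add_distrib, apply_ite (starRingEnd ℂ), c3, c4, c5]; norm_num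
          · simp [h, h', hj, hj2, Ne.symm hj, Ne.symm hj2, add_mul, Finset.sum_add_distrib,
              apply_ite (starRingEnd ℂ)]
      · simp [hi, hi2, apply_ite (starRingEnd ℂ)]
        by_cases hj : j = x
        · subst hj
          simp [hi, hi2]
        · by_cases hj2 : j = z
          · subst hj2
            simp [hi, hi2, hj]
          · simp [hj, hj2, eq_comm]
  have key := hT_inv μ r ⟨_, hW⟩ x x x x
  have e : ∀ U, ((Matrix.of fun i j => if j = x then
        ((if i = x then (3/5:ℂ) else 0) + (if i = z then (4/5:ℂ) else 0))
      else if j = z then ((if i = x then (-4/5:ℂ) else 0) + (if i = z then (3/5:ℂ) else 0))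
      else if i = j then 1 else 0)ᴴ * hG r U * (Matrix.of fun i j => if j = x then
        ((if i = x then (3/5:ℂ) else 0) + (if i = z then (4/5:ℂ) else 0))
      else if j = z then ((if i = x then (-4/5:ℂ) else 0) + (if i = z then (3/5:ℂ) else 0))
      else if i = j then 1 else 0)) x x = ∑ p : Bool × Bool,
        ((bif p.1 then 3/5 else 4/5) * (bif p.2 then 3/5 else 4/5)) *
          hG r U (bif p.1 then x else z) (bif p.2 then x else z) := by
    intro U
    simp [Matrix.mul_apply, h, h', add_mul, mul_add, Finset.sum_add_distrib, apply_ite (starRingEnd ℂ),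
      c3, c4, c5]
    simp [Fintype.sum_prod_type]
    ring
  simp only [e] at key
  rw [hT_multi] at key
  have z1 : hT μ r x x x z = 0 := hT_zero μ r _ _ _ _ (by simp [h]) (by simp [h])
  have z2 : hT μ r x x z x = 0 := hT_zero μ r _ _ _ _ (by simp [h']) (by simp [h])
  have z3 : hT μ r x z x x = 0 := hT_zero μ r _ _ _ _ (by simp [h]) (by simp [h'])
  have z4 : hT μ r z x x x = 0 := hT_zero μ r _ _ _ _ (by simp [h']) (by simp [h'])
  have z5 : hT μ r x z x z = 0 := hT_zero μ r _ _ _ _ (by simp [h]) (by simp [h])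
  have z6 : hT μ r z x z x = 0 := hT_zero μ r _ _ _ _ (by simp [h']) (by simp [h'])
  have z7 : hT μ r z z z x = 0 := hT_zero μ r _ _ _ _ (by simp [h']) (by simp [h'])
  have z8 : hT μ r z z x z = 0 := hT_zero μ r _ _ _ _ (by simp [h]) (by simp [h'])
  have z9 : hT μ r z x z z = 0 := hT_zero μ r _ _ _ _ (by simp [h']) (by simp [h])
  have z10 : hT μ r x z z z = 0 := hT_zero μ r _ _ _ _ (by simp [h]) (by simp [h])
  have p1 := hT_perm μ r (Equiv.swap x z) x x x x
  have p2 := hT_perm μ r (Equiv.swap x z) x x z z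
  have p3 := hT_perm μ r (Equiv.swap x z) x z z x
  simp only [Equiv.swap_apply_left, Equiv.swap_apply_right] at p1 p2 p3
  simp only [Fintype.sum_prod_type, Fintype.sum_bool, cond_true, cond_false,
    z1, z2, z3, z4, z5, z6, z7, z8, z9, z10, p1, p2, p3] at key
  linear_combination (-625 / 288 : ℂ) * key

lemma hT_formula (r : κ → ι) (x₀ z₀ : ι) (h₀ : x₀ ≠ z₀) (x y z w : ι) :
    hT μ r x y z w = hT μ r x₀ x₀ z₀ z₀ * (if x = y ∧ z = w then 1 else 0) +
      hT μ r x₀ z₀ z₀ x₀ * (if x = w ∧ y = z then 1 else 0) := by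
  by_cases h1 : x = y ∧ z = w
  · obtain ⟨rfl, rfl⟩ := h1
    by_cases h : x = z
    · subst h
      obtain ⟨σ, hσ⟩ : ∃ σ : Equiv.Perm ι, σ x₀ = x := ⟨Equiv.swap x₀ x, by simp⟩
      have := hT_perm μ r σ x₀ x₀ x₀ x₀
      rw [hσ] at this
      simp [this, hT_had μ r x₀ z₀ h₀]
    · obtain ⟨σ, rfl, rfl⟩ := exists_perm2 h₀ h
      rw [hT_perm]
      simp [h₀]
  · by_cases h2 : x = w ∧ y = z
    · obtain ⟨rfl, rfl⟩ := h2
      have h : x ≠ y := by rintro rfl; simp at h1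
      obtain ⟨σ, rfl, rfl⟩ := exists_perm2 h₀ h
      rw [hT_perm]
      simp [h₀]
    · rw [hT_zero μ r x y z w h1 h2]; simp [h1, h2]

lemma hT_eq1 (r : κ → ι) (hr : Function.Injective r) (x₀ z₀ : ι) (h₀ : x₀ ≠ z₀) :
    (Fintype.card ι : ℂ) ^ 2 * hT μ r x₀ x₀ z₀ z₀ + Fintype.card ι * hT μ r x₀ z₀ z₀ x₀ =
      (Fintype.card κ : ℂ) ^ 2 := by
  rw [← hT_tr μ r hr]
  have := fun x z => hT_formula μ r x₀ z₀ h₀ x x z z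
  generalize hT μ r x₀ x₀ z₀ z₀ = a at *
  generalize hT μ r x₀ z₀ z₀ x₀ = b at *
  simp_rw [this]
  simp [Finset.sum_add_distrib, h₀]
  ring

lemma hT_eq2 (r : κ → ι) (hr : Function.Injective r) (x₀ z₀ : ι) (h₀ : x₀ ≠ z₀) :
    (Fintype.card ι : ℂ) * hT μ r x₀ x₀ z₀ z₀ + Fintype.card ι ^ 2 * hT μ r x₀ z₀ z₀ x₀ =
      (Fintype.card κ : ℂ) := by
  rw [← hT_tr2 μ r hr]
  have := fun x z => hT_formula μ r x₀ z₀ h₀ x z z x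
  generalize hT μ r x₀ x₀ z₀ z₀ = a at *
  generalize hT μ r x₀ z₀ z₀ x₀ = b at *
  simp_rw [this]
  have e : ∀ x z : ι, (x = z ∧ z = x) ↔ x = z := by grind
  simp [Finset.sum_add_distrib, e]
  ring
end helpers

lemma sliceV_entry (P d m : ℕ) (hP : 0 < P) (U : Matrix.unitaryGroup (Fin P × Fin d) ℂ)
    (a b : (Fin P × Fin d) × Fin m) :
    ((sliceVMatrix P d m hP U)ᴴ * sliceVMatrix P d m hP U) a b =
      if a.2 = b.2 then
        (P : ℂ) * hG (fun j : Fin d => ((⟨0, hP⟩ : Fin P), j)) U a.1 b.1 else 0 := by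
  have hs : ((Real.sqrt P : ℝ) : ℂ) * ((Real.sqrt P : ℝ) : ℂ) = P := by
    rw [← Complex.ofReal_mul, Real.mul_self_sqrt (Nat.cast_nonneg P), Complex.ofReal_natCast]
  rw [Matrix.mul_apply, Fintype.sum_prod_type]
  simp only [Matrix.conjTranspose_apply, sliceVMatrix, hG, hB, Matrix.mul_apply,
    Matrix.submatrix_apply, id]
  by_cases h : a.2 = b.2
  · simp only [h, if_true, Finset.mul_sum]
    refine Finset.sum_congr rfl fun j _ => ?_
    rw [Finset.sum_eq_single b.2]
    · simp [← hs]; ring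
    · intro y _ hy
      simp [hy]
    · simp
  · rw [if_neg h]
    refine Finset.sum_eq_zero fun j _ => Finset.sum_eq_zero fun y _ => ?_
    by_cases h1 : y = b.2
    · have : y ≠ a.2 := fun e => h (e.symm.trans h1)
      simp [this]
    · simp [h1]

lemma matrix_integral_apply {Ω n : Type*} [Fintype n] [MeasurableSpace Ω] (μ : Measure Ω)
    (F : Ω → Matrix n n ℂ) (hF : ∀ i j, Integrable (fun U => F U i j) μ) (i j : n) :
    (∫ U, F U ∂μ) i j = ∫ U, F U i j ∂μ := by
  have h1 : ∀ i, Integrable (fun U => (fun j => F U i j : n → ℂ)) μ :=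
    fun i => Integrable.of_eval fun j => hF i j
  have e1 : (∫ U, (fun i j => F U i j : n → n → ℂ) ∂μ) i = ∫ U, (fun j => F U i j : n → ℂ) ∂μ :=
    eval_integral (fun i => h1 i) i
  have e2 : (∫ U, (fun j => F U i j : n → ℂ) ∂μ) j = ∫ U, F U i j ∂μ :=
    eval_integral (fun j => hF i j) j
  rw [← e2, ← e1]
  rfl

/-- **Master second-moment operator identity.**  Assume `Pd ≥ 2`.  Then
`∫ (V(U)†V(U)) ⊗ (V(U)†V(U)) dμ(U)
  = [P(P·d² − 1)/(P²d² − 1)] • Id + [P·d(P − 1)/(P²d² − 1)] • F_in`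
as operators on `(ℂ^{Pd} ⊗ ℂ^m) ⊗ (ℂ^{Pd} ⊗ ℂ^m)`, where `μ` is the Haar probability
measure (the left- and right-invariant Borel probability measure) on `U(Pd)`. -/
theorem sliceV_master_second_moment (P d m : ℕ) (hP : 0 < P) (hd : 0 < d) (hm : 0 < m)
    (hPd : 2 ≤ P * d)
    (μ : Measure (Matrix.unitaryGroup (Fin P × Fin d) ℂ))
    [IsProbabilityMeasure μ] [μ.IsMulLeftInvariant] [μ.IsMulRightInvariant] :
    ∫ U, ((sliceVMatrix P d m hP U)ᴴ * sliceVMatrix P d m hP U) ⊗ₖ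
          ((sliceVMatrix P d m hP U)ᴴ * sliceVMatrix P d m hP U) ∂μ
      = (((P : ℂ) * ((P : ℂ) * (d : ℂ) ^ 2 - 1)) / ((P : ℂ) ^ 2 * (d : ℂ) ^ 2 - 1)) •
            (1 : Matrix ((((Fin P × Fin d) × Fin m)) × (((Fin P × Fin d) × Fin m)))
                  ((((Fin P × Fin d) × Fin m)) × (((Fin P × Fin d) × Fin m))) ℂ)
        + (((P : ℂ) * (d : ℂ) * ((P : ℂ) - 1)) / ((P : ℂ) ^ 2 * (d : ℂ) ^ 2 - 1)) •
            swapInMatrix P d m := by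
  have hr : Function.Injective (fun j : Fin d => ((⟨0, hP⟩ : Fin P), j)) :=
    fun a b h => (Prod.ext_iff.1 h).2
  have hcard : 1 < Fintype.card (Fin P × Fin d) := by simp; omega
  obtain ⟨x₀, z₀, h₀⟩ := Fintype.exists_pair_of_one_lt_card hcard
  have E1 := hT_eq1 μ _ hr x₀ z₀ h₀
  have E2 := hT_eq2 μ _ hr x₀ z₀ h₀
  have F := hT_formula μ (fun j : Fin d => ((⟨0, hP⟩ : Fin P), j)) x₀ z₀ h₀
  have ent : ∀ (p q : ((Fin P × Fin d) × Fin m) × ((Fin P × Fin d) × Fin m)) U,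
      (((sliceVMatrix P d m hP U)ᴴ * sliceVMatrix P d m hP U) ⊗ₖ
          ((sliceVMatrix P d m hP U)ᴴ * sliceVMatrix P d m hP U)) p q =
      (if p.1.2 = q.1.2 ∧ p.2.2 = q.2.2 then (P : ℂ) ^ 2 else 0) *
        (hG (fun j : Fin d => ((⟨0, hP⟩ : Fin P), j)) U p.1.1 q.1.1 *
          hG (fun j : Fin d => ((⟨0, hP⟩ : Fin P), j)) U p.2.1 q.2.1) := by
    intro p q U
    rw [Matrix.kroneckerMap_apply, sliceV_entry, sliceV_entry]
    by_cases h1 : p.1.2 = q.1.2 <;> by_cases h2 : p.2.2 = q.2.2 <;> simp [h1, h2]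
    ring
  ext p q
  rw [matrix_integral_apply μ _ (fun i j => by
    simp_rw [ent]
    exact (hG_int μ _ _ _ _ _).const_mul _)]
  simp_rw [ent]
  rw [integral_const_mul]
  change _ * hT μ (fun j : Fin d => ((⟨0, hP⟩ : Fin P), j)) p.1.1 q.1.1 p.2.1 q.2.1 = _
  rw [F]
  generalize hT μ (fun j : Fin d => ((⟨0, hP⟩ : Fin P), j)) x₀ x₀ z₀ z₀ = β at *
  generalize hT μ (fun j : Fin d => ((⟨0, hP⟩ : Fin P), j)) x₀ z₀ z₀ x₀ = γ at *
  simp only [Fintype.card_prod, Fintype.card_fin, Nat.cast_mul] at E1 E2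
  have hP0 : (P : ℂ) ≠ 0 := by exact_mod_cast hP.ne'
  have hd0 : (d : ℂ) ≠ 0 := by exact_mod_cast hd.ne'
  have hN : (P : ℂ) ^ 2 * (d : ℂ) ^ 2 - 1 ≠ 0 := by
    rw [← mul_pow, sub_ne_zero]
    have : (P * d) ^ 2 ≠ 1 := by nlinarith
    exact_mod_cast this
  have hβ : ((P : ℂ) * ((P : ℂ) * (d : ℂ) ^ 2 - 1)) / ((P : ℂ) ^ 2 * (d : ℂ) ^ 2 - 1)
      = (P : ℂ) ^ 2 * β := by
    rw [div_eq_iff hN]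
    apply mul_left_cancel₀ hd0
    linear_combination (-P ^ 2 * d : ℂ) * E1 + (P : ℂ) * E2
  have hγ : ((P : ℂ) * (d : ℂ) * ((P : ℂ) - 1)) / ((P : ℂ) ^ 2 * (d : ℂ) ^ 2 - 1)
      = (P : ℂ) ^ 2 * γ := by
    rw [div_eq_iff hN]
    apply mul_left_cancel₀ hd0
    linear_combination (P : ℂ) * E1 - (P ^ 2 * d : ℂ) * E2
  rw [hβ, hγ]
  simp only [Matrix.add_apply, Matrix.smul_apply, Matrix.one_apply, swapInMatrix, smul_eq_mul]
  obtain ⟨⟨x, a⟩, ⟨z, b⟩⟩ := p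
  obtain ⟨⟨x', a'⟩, ⟨z', b'⟩⟩ := q
  simp only [Prod.mk.injEq]
  by_cases h1 : a = a' <;> by_cases h2 : b = b' <;> simp [h1, h2]
  have : (x = z' ∧ x' = z) ↔ (x = z' ∧ z = x') := by rw [eq_comm (a := x')]
  simp only [this]
  split_ifs <;> ring
end

section
/- Two-layer composition bound: assume P₁d₁ ≥ 2 and P₂d₂ ≥ 2, that d₂·m₂ = P₁·d₁·m₁, and fix a unitary (inner-product preserving linear) isomorphism ι : ℂ^{d₂} ⊗ ℂ^{m₂} → ℂ^{P₁d₁} ⊗ ℂ^{m₁}. Let V(U₁, U₂) = V₁(U₁) ∘ ι ∘ V₂(U₂) be the two-layer slice-normal network, with U₁ and U₂ independent Haar-random unitaries. Then for all unit vectors ψ₁, ψ₂ ∈ ℂ^{P₂d₂} ⊗ ℂ^{m₂}, ∫∫ |⟨ψ₁, V(U₁,U₂)†V(U₁,U₂) ψ₂⟩ − ⟨ψ₁, ψ₂⟩|² dμ₁(U₁) dμ₂(U₂) ≤ 8·(1/d₁ + 1/d₂). -/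
open MeasureTheory ComplexConjugate
open scoped Matrix

set_option linter.unusedSectionVars false

namespace TL
open Matrix

variable {n : Type*} [Fintype n] [DecidableEq n]

instance compactU : CompactSpace (Matrix.unitaryGroup n ℂ) := by
  refine (isCompact_iff_compactSpace (s := (Matrix.unitaryGroup n ℂ : Set (Matrix n n ℂ)))).1 ?_
  have hK : IsCompact (Set.pi Set.univ fun _ : n => Set.pi Set.univ fun _ : n =>
      Metric.closedBall (0 : ℂ) 1) :=
    isCompact_univ_pi fun _ => isCompact_univ_pi fun _ => isCompact_closedBall _ _
  refine IsCompact.of_isClosed_subset hK ?_ ?_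
  · have : (Matrix.unitaryGroup n ℂ : Set (Matrix n n ℂ)) = {A | A * Aᴴ = 1} := by
      ext A
      simp only [SetLike.mem_coe, Matrix.mem_unitaryGroup_iff, Set.mem_ofPred_eq]
      rfl
    rw [this]
    exact isClosed_eq (by fun_prop) continuous_const
  · intro A hA i _ j _
    simpa using entry_norm_bound_of_unitary hA i j

/-- conjugated matrix -/
noncomputable def Q (M : Matrix n n ℂ) (U : Matrix.unitaryGroup n ℂ) : Matrix n n ℂ :=
  (U : Matrix n n ℂ)ᴴ * M * (U : Matrix n n ℂ)

lemma Q_cont (M : Matrix n n ℂ) : Continuous (Q M) := by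
  unfold Q
  have h : Continuous fun U : Matrix.unitaryGroup n ℂ => (U : Matrix n n ℂ) :=
    continuous_subtype_val
  fun_prop

lemma intg (μ : Measure (Matrix.unitaryGroup n ℂ)) [IsProbabilityMeasure μ]
    {f : Matrix.unitaryGroup n ℂ → ℝ} (hf : Continuous f) : Integrable f μ :=
  hf.integrable_of_hasCompactSupport (HasCompactSupport.of_compactSpace f)

/-- second moment -/
noncomputable def T (μ : Measure (Matrix.unitaryGroup n ℂ)) (M A : Matrix n n ℂ) : ℝ :=
  ∫ U, ‖trace (Q M U * A)‖ ^ 2 ∂μ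

lemma T_conj (μ : Measure (Matrix.unitaryGroup n ℂ)) [μ.IsMulRightInvariant]
    (M A : Matrix n n ℂ) (W : Matrix.unitaryGroup n ℂ) :
    T μ M ((W : Matrix n n ℂ) * A * (W : Matrix n n ℂ)ᴴ) = T μ M A := by
  unfold T
  rw [← integral_mul_right_eq_self (fun U => ‖trace (Q M U * A)‖ ^ 2) W]
  congr 1
  ext U
  have : trace (Q M U * ((W : Matrix n n ℂ) * A * (W : Matrix n n ℂ)ᴴ))
      = trace (Q M (U * W) * A) := by
    rw [← mul_assoc, trace_mul_comm]
    simp only [Q, Submonoid.coe_mul, conjTranspose_mul, mul_assoc]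
  rw [this]

lemma T_perm (μ : Measure (Matrix.unitaryGroup n ℂ)) [μ.IsMulRightInvariant]
    (M : Matrix n n ℂ) (v : n → ℂ) (σ : Equiv.Perm n) :
    T μ M (diagonal (v ∘ σ)) = T μ M (diagonal v) := by
  have hW : (1 : Matrix n n ℂ).submatrix σ id ∈ Matrix.unitaryGroup n ℂ := by
    rw [Matrix.mem_unitaryGroup_iff]
    ext i j
    simp [Matrix.mul_apply, Matrix.one_apply, eq_comm]
  have := T_conj μ M (diagonal v) ⟨_, hW⟩
  rw [← this]
  congr 1
  ext i j
  simp only [Matrix.mul_apply, diagonal_apply, Matrix.one_apply, submatrix_apply, id,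
    conjTranspose_apply]
  by_cases h : i = j
  · subst h; simp
  · simp [h, eq_comm]

/-- Hilbert-Schmidt norm squared -/
noncomputable def fro (A : Matrix n n ℂ) : ℝ := (trace (Aᴴ * A)).re

omit [DecidableEq n] in
lemma fro_eq (A : Matrix n n ℂ) : fro A = ∑ i, ∑ j, ‖A i j‖ ^ 2 := by
  simp only [fro, trace, diag_apply, mul_apply, conjTranspose_apply, Complex.re_sum]
  rw [Finset.sum_comm]
  refine Finset.sum_congr rfl fun i _ => Finset.sum_congr rfl fun j _ => ?_
  rw [← Complex.normSq_eq_norm_sq, Complex.normSq_apply]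
  simp

lemma Q_herm {M : Matrix n n ℂ} (hM : M.IsHermitian) (U) : (Q M U).IsHermitian :=
  isHermitian_conjTranspose_mul_mul _ hM

lemma tr_diag {M : Matrix n n ℂ} (hM : M.IsHermitian) (U) (l : n → ℝ) :
    trace (Q M U * diagonal (fun i => (l i : ℂ))) = ((∑ i, l i * (Q M U i i).re : ℝ) : ℂ) := by
  simp only [trace, diag_apply, mul_diagonal]
  push_cast
  refine Finset.sum_congr rfl fun i _ => ?_
  have := (Q_herm hM U).coe_re_apply_self i
  conv_lhs => rw [← this]
  rw [mul_comm]; rfl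

lemma T_diag (μ : Measure (Matrix.unitaryGroup n ℂ)) {M : Matrix n n ℂ}
    (hM : M.IsHermitian) (l : n → ℝ) :
    T μ M (diagonal fun i => (l i : ℂ)) = ∫ U, (∑ i, l i * (Q M U i i).re) ^ 2 ∂μ := by
  unfold T
  simp only [tr_diag hM, Complex.norm_real, Real.norm_eq_abs, sq_abs]

/-- pair moment -/
noncomputable def c (μ : Measure (Matrix.unitaryGroup n ℂ)) (M : Matrix n n ℂ) (i j : n) : ℝ :=
  ∫ U, ((Q M U i i).re - (Q M U j j).re) ^ 2 ∂μ

lemma c_eqT (μ : Measure (Matrix.unitaryGroup n ℂ)) {M : Matrix n n ℂ}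
    (hM : M.IsHermitian) (i j : n) :
    c μ M i j = T μ M (diagonal fun k => (((if k = i then 1 else 0) - (if k = j then 1 else 0) : ℝ) : ℂ)) := by
  rw [T_diag μ hM]
  simp [c, sub_mul, Finset.sum_sub_distrib]

lemma c_symm (μ : Measure (Matrix.unitaryGroup n ℂ)) (M : Matrix n n ℂ) (i j : n) :
    c μ M i j = c μ M j i := by
  unfold c
  congr 1; ext U; ring

lemma c_swap (μ : Measure (Matrix.unitaryGroup n ℂ)) [μ.IsMulRightInvariant] {M : Matrix n n ℂ}
    (hM : M.IsHermitian) {i j k : n} (hj : j ≠ i) (hk : k ≠ i) :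
    c μ M i j = c μ M i k := by
  rw [c_eqT μ hM, c_eqT μ hM, ← T_perm μ M _ (Equiv.swap j k)]
  congr 2
  ext x
  have h1 : Equiv.swap j k x = i ↔ x = i := by
    rw [← Equiv.eq_symm_apply, Equiv.symm_swap,
      Equiv.swap_apply_of_ne_of_ne hj.symm hk.symm]
  have h2 : Equiv.swap j k x = j ↔ x = k := by
    rw [← Equiv.eq_symm_apply, Equiv.symm_swap, Equiv.swap_apply_left]
  simp [h1, h2]

lemma c_all (μ : Measure (Matrix.unitaryGroup n ℂ)) [μ.IsMulRightInvariant] {M : Matrix n n ℂ}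
    (hM : M.IsHermitian) {i j k l : n} (hij : i ≠ j) (hkl : k ≠ l) :
    c μ M i j = c μ M k l := by
  by_cases h : k = i
  · subst h; exact c_swap μ hM hij.symm hkl.symm
  · rw [c_swap μ hM hij.symm h, c_symm, c_swap μ hM (Ne.symm h) hkl.symm]

lemma T_diag' (μ : Measure (Matrix.unitaryGroup n ℂ)) [IsProbabilityMeasure μ]
    [μ.IsMulRightInvariant] {M : Matrix n n ℂ}
    (hM : M.IsHermitian) {a b : n} (hab : a ≠ b) (l : n → ℝ) (hl : ∑ i, l i = 0) :
    T μ M (diagonal fun i => (l i : ℂ)) = c μ M a b / 2 * ∑ i, l i ^ 2 := by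
  rw [T_diag μ hM]
  have key : ∀ q : n → ℝ, (∑ i, l i * q i) ^ 2
      = ∑ i, ∑ j, (- (l i * l j) / 2) * (q i - q j) ^ 2 := by
    intro q
    have h : ∀ i j, (- (l i * l j) / 2) * (q i - q j) ^ 2
      = (l i * q i) * (l j * q j) - (l i * q i ^ 2) * l j / 2 - l i * (l j * q j ^ 2) / 2 := by
      intros; ring
    simp only [h, Finset.sum_sub_distrib, ← Finset.mul_sum, ← Finset.sum_mul, ← Finset.sum_div, hl]
    ring
  simp only [key]
  have hc : ∀ i j, Continuous fun U => (Q M U i i).re - (Q M U j j).re := by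
    intro i j
    have := Q_cont M
    fun_prop
  rw [integral_finsetSum _ fun i _ => intg μ (by have := hc i; fun_prop)]
  have h2 : ∀ i, ∫ U, ∑ j, (- (l i * l j) / 2) * ((Q M U i i).re - (Q M U j j).re) ^ 2 ∂μ
      = ∑ j, (- (l i * l j) / 2) * c μ M i j := by
    intro i
    rw [integral_finsetSum _ fun j _ => intg μ (by have := hc i; fun_prop)]
    simp only [integral_const_mul, c]
  simp only [h2]
  have h3 : ∀ i j, (- (l i * l j) / 2) * c μ M i j
      = (- (l i * l j) / 2) * c μ M a b + if i = j then l i ^ 2 / 2 * c μ M a b else 0 := by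
    intro i j
    split_ifs with h
    · subst h
      have : c μ M i i = 0 := by simp [c]
      rw [this]; ring
    · rw [c_all μ hM h hab]; ring
  simp only [h3, Finset.sum_add_distrib, Finset.sum_ite_eq, Finset.mem_univ, if_true,
    ← Finset.sum_mul, ← Finset.sum_div, Finset.sum_neg_distrib, ← Finset.mul_sum, hl]
  ring

lemma T_herm (μ : Measure (Matrix.unitaryGroup n ℂ)) [IsProbabilityMeasure μ]
    [μ.IsMulRightInvariant] {M : Matrix n n ℂ}
    (hM : M.IsHermitian) {a b : n} (hab : a ≠ b) {H : Matrix n n ℂ} (hH : H.IsHermitian)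
    (ht : trace H = 0) :
    T μ M H = c μ M a b / 2 * fro H := by
  have hs := hH.spectral_theorem
  rw [Unitary.conjStarAlgAut_apply] at hs
  set W := hH.eigenvectorUnitary
  set D : Matrix n n ℂ := diagonal (fun i => (hH.eigenvalues i : ℂ)) with hD
  have hs' : H = (W : Matrix n n ℂ) * D * (W : Matrix n n ℂ)ᴴ := hs
  have hW : (W : Matrix n n ℂ)ᴴ * (W : Matrix n n ℂ) = 1 :=
    Matrix.mem_unitaryGroup_iff'.1 W.2
  have h1 : T μ M H = T μ M D := by
    rw [hs']; exact T_conj μ M D W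
  have h2 : fro H = ∑ i, hH.eigenvalues i ^ 2 := by
    have : trace (Hᴴ * H) = trace (Dᴴ * D) := by
      rw [hs']
      simp only [conjTranspose_mul, conjTranspose_conjTranspose]
      calc _ = trace ((W : Matrix n n ℂ) * (Dᴴ * (((W : Matrix n n ℂ)ᴴ * (W : Matrix n n ℂ)) * D) * (W : Matrix n n ℂ)ᴴ)) := by
            simp only [mul_assoc]
        _ = _ := by
            rw [hW, one_mul, trace_mul_comm, mul_assoc, hW, mul_one]
    rw [fro, this, hD, diagonal_conjTranspose, diagonal_mul_diagonal, trace_diagonal]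
    simp [Complex.re_sum, sq]
  have h3 : ∑ i, hH.eigenvalues i = 0 := by
    have := hH.trace_eq_sum_eigenvalues
    rw [ht] at this
    have h := congrArg Complex.re this.symm
    simpa [Complex.re_sum] using h
  rw [h1, h2, hD, T_diag' μ hM hab _ h3]

lemma tr_real {A B : Matrix n n ℂ} (hA : A.IsHermitian) (hB : B.IsHermitian) :
    (trace (A * B)).im = 0 := by
  have : star (trace (A * B)) = trace (A * B) := by
    rw [← trace_conjTranspose, conjTranspose_mul, hA.eq, hB.eq, trace_mul_comm]
  exact Complex.conj_eq_iff_im.1 this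

lemma T_gen (μ : Measure (Matrix.unitaryGroup n ℂ)) [IsProbabilityMeasure μ]
    [μ.IsMulRightInvariant] {M : Matrix n n ℂ}
    (hM : M.IsHermitian) {a b : n} (hab : a ≠ b) {A : Matrix n n ℂ} (ht : trace A = 0) :
    T μ M A = c μ M a b / 2 * fro A := by
  set H : Matrix n n ℂ := (1/2 : ℂ) • (A + Aᴴ) with hH
  set K : Matrix n n ℂ := (-Complex.I/2 : ℂ) • (A - Aᴴ) with hK
  have hHh : H.IsHermitian := by
    rw [Matrix.IsHermitian, hH, conjTranspose_smul, conjTranspose_add, conjTranspose_conjTranspose,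
      add_comm]
    simp
  have hKh : K.IsHermitian := by
    rw [Matrix.IsHermitian, hK, conjTranspose_smul, conjTranspose_sub, conjTranspose_conjTranspose,
      ← neg_sub, smul_neg, ← neg_smul]
    congr 1
    simp [neg_div]
  have hA : A = H + Complex.I • K := by
    rw [hH, hK, smul_smul]
    have : Complex.I * (-Complex.I / 2) = 1/2 := by
      rw [mul_div_assoc', mul_neg, Complex.I_mul_I]; norm_num
    rw [this]
    ext i j
    simp
    ring
  have hts : trace Aᴴ = 0 := by rw [trace_conjTranspose, ht, star_zero]
  have htH : trace H = 0 := by rw [hH, trace_smul, trace_add, ht, hts]; simp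
  have htK : trace K = 0 := by rw [hK, trace_smul, trace_sub, ht, hts]; simp
  have hfro : fro A = fro H + fro K := by
    rw [hA]
    have h1 : trace (K * H) = trace (H * K) := trace_mul_comm _ _
    simp only [fro, conjTranspose_add, conjTranspose_smul, hHh.eq, hKh.eq, add_mul, mul_add,
      trace_add, smul_mul_assoc, mul_smul_comm, trace_smul, h1]
    simp
    ring
  have hpt : ∀ U, ‖trace (Q M U * A)‖ ^ 2 = ‖trace (Q M U * H)‖ ^ 2 + ‖trace (Q M U * K)‖ ^ 2 := by
    intro U
    have h1 := tr_real (Q_herm hM U) hHh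
    have h2 := tr_real (Q_herm hM U) hKh
    rw [hA]
    simp only [mul_add, trace_add, mul_smul_comm, trace_smul, ← Complex.normSq_eq_norm_sq,
      Complex.normSq_apply, smul_eq_mul, Complex.add_re, Complex.add_im, Complex.mul_re,
      Complex.mul_im, Complex.I_re, Complex.I_im, h1, h2]
    ring
  have hcont : ∀ B : Matrix n n ℂ, Continuous fun U => ‖trace (Q M U * B)‖ ^ 2 := by
    intro B
    have := Q_cont M
    fun_prop
  have hT : T μ M A = T μ M H + T μ M K := by
    unfold T
    rw [← integral_add (intg μ (hcont H)) (intg μ (hcont K))]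
    simp only [hpt]
  rw [hT, hfro, T_herm μ hM hab hHh htH, T_herm μ hM hab hKh htK]
  ring

/-- squared norm -/
noncomputable def nrm {ι : Type*} [Fintype ι] (f : ι → ℂ) : ℝ := ∑ x, ‖f x‖ ^ 2

lemma inn_self {ι : Type*} [Fintype ι] (f : ι → ℂ) : inn f f = (nrm f : ℂ) := by
  simp only [inn, nrm, Complex.conj_mul']
  push_cast
  rfl

/-- the slice projector, scaled -/
noncomputable def M0 (P d : ℕ) (hP : 0 < P) : Matrix (Fin P × Fin d) (Fin P × Fin d) ℂ :=
  diagonal fun i => if i.1 = ⟨0, hP⟩ then (P : ℂ) else 0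

lemma M0_herm (P d : ℕ) (hP : 0 < P) : (M0 P d hP).IsHermitian := by
  rw [Matrix.IsHermitian, M0, diagonal_conjTranspose]
  congr 1
  ext i
  simp only [Pi.star_apply]
  split_ifs <;> simp

lemma M0_sq (P d : ℕ) (hP : 0 < P) : M0 P d hP * M0 P d hP = (P : ℂ) • M0 P d hP := by
  rw [M0, diagonal_mul_diagonal, ← diagonal_smul]
  congr 1
  ext i
  by_cases h : i.1 = ⟨0, hP⟩ <;> simp [h]

lemma M0_trace (P d : ℕ) (hP : 0 < P) : trace (M0 P d hP) = (P : ℂ) * d := by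
  rw [M0, trace_diagonal, Fintype.sum_prod_type_right]
  simp [mul_comm]

lemma Q_trace (M : Matrix n n ℂ) (U) : trace (Q M U) = trace M := by
  have hU : (U : Matrix n n ℂ) * (U : Matrix n n ℂ)ᴴ = 1 := Matrix.mem_unitaryGroup_iff.1 U.2
  rw [Q, mul_assoc, trace_mul_comm, mul_assoc, hU, mul_one]

lemma Q_mul (M : Matrix n n ℂ) (U) : Q M U * Q M U = Q (M * M) U := by
  have hU : (U : Matrix n n ℂ) * (U : Matrix n n ℂ)ᴴ = 1 := Matrix.mem_unitaryGroup_iff.1 U.2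
  calc Q M U * Q M U = (U : Matrix n n ℂ)ᴴ * M * ((U : Matrix n n ℂ) * (U : Matrix n n ℂ)ᴴ) * M * (U : Matrix n n ℂ) := by
        simp only [Q, mul_assoc]
    _ = _ := by rw [hU, mul_one, Q, ← mul_assoc]

lemma c_bound (P d : ℕ) (hP : 0 < P) (hd : 0 < d) (hD : 2 ≤ P * d)
    (μ : Measure (Matrix.unitaryGroup (Fin P × Fin d) ℂ)) [IsProbabilityMeasure μ]
    [μ.IsMulRightInvariant] {a b : Fin P × Fin d} (hab : a ≠ b) :
    c μ (M0 P d hP) a b / 2 ≤ 1 / d := by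
  set M := M0 P d hP with hM0
  have hM : M.IsHermitian := M0_herm P d hP
  set D : ℝ := P * d with hDdef
  have hfro : ∀ U, fro (Q M U - 1) = D * (P - 1) := by
    intro U
    have h1 : (Q M U - 1)ᴴ * (Q M U - 1) = Q M U * Q M U - Q M U - Q M U + 1 := by
      rw [conjTranspose_sub, (Q_herm hM U).eq, conjTranspose_one]
      noncomm_ring
    rw [fro, h1, Q_mul, trace_add, trace_sub, trace_sub, Q_trace, Q_trace, M0_sq, trace_smul,
      M0_trace, trace_one]
    simp
    ring
  have hE : ∀ i j, i ≠ j → ∫ U, ‖(Q M U - 1) i j‖ ^ 2 ∂μ = c μ M a b / 2 := by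
    intro i j hij
    have h := T_gen μ hM hab (A := single j i 1) (trace_single_eq_of_ne _ _ _ hij.symm)
    have hf : fro (single j i (1 : ℂ)) = 1 := by
      rw [fro, conjTranspose_single, single_mul_single_same, trace_single_eq_same]
      simp
    rw [hf, mul_one] at h
    rw [← h, T]
    congr 1
    ext U
    rw [trace_mul_single]
    simp [hij]
  have hcont : ∀ i j, Continuous fun U => ‖(Q M U - 1) i j‖ ^ 2 := by
    intro i j
    have := Q_cont M
    fun_prop
  have hle : ∑ i : Fin P × Fin d, ∑ j : Fin P × Fin d, (if i = j then 0 else c μ M a b / 2) ≤ D * (P - 1) := by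
    calc _ ≤ ∑ i, ∑ j, ∫ U, ‖(Q M U - 1) i j‖ ^ 2 ∂μ := by
          refine Finset.sum_le_sum fun i _ => Finset.sum_le_sum fun j _ => ?_
          split_ifs with h
          · exact integral_nonneg fun U => by positivity
          · rw [hE i j h]
      _ = ∫ U, fro (Q M U - 1) ∂μ := by
          simp only [fro_eq]
          rw [integral_finsetSum _ fun i _ => intg μ (continuous_finset_sum _ fun j _ => hcont i j)]
          refine Finset.sum_congr rfl fun i _ => ?_
          rw [integral_finsetSum _ fun j _ => intg μ (hcont i j)]
      _ = _ := by simp [hfro]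
  have hs : ∑ i : Fin P × Fin d, ∑ j, (if i = j then 0 else c μ M a b / 2)
      = D * (D - 1) * (c μ M a b / 2) := by
    have : ∀ i j : Fin P × Fin d, (if i = j then 0 else c μ M a b / 2)
        = c μ M a b / 2 - if i = j then c μ M a b / 2 else 0 := by
      intro i j; split_ifs <;> simp
    simp only [this, Finset.sum_sub_distrib]
    simp
    ring
  rw [hs] at hle
  have hD2 : (2 : ℝ) ≤ D := by rw [hDdef]; exact_mod_cast hD
  have hd1 : (1 : ℝ) ≤ d := by exact_mod_cast hd
  have hP1 : (1 : ℝ) ≤ P := by exact_mod_cast hP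
  have h1 : (D - 1) * (c μ M a b / 2) ≤ P - 1 := by
    have : D * ((D - 1) * (c μ M a b / 2)) ≤ D * (P - 1) := by linarith
    exact le_of_mul_le_mul_left this (by linarith)
  rw [le_div_iff₀ (by linarith)]
  have h2 : (D - 1) * (c μ M a b / 2 * d) ≤ (D - 1) * 1 := by
    calc _ = ((D - 1) * (c μ M a b / 2)) * d := by ring
      _ ≤ (P - 1) * d := by gcongr
      _ = D - d := by rw [hDdef]; ring
      _ ≤ _ := by linarith
  exact le_of_mul_le_mul_left h2 (by linarith)

lemma mat_bound (P d : ℕ) (hP : 0 < P) (hd : 0 < d) (hD : 2 ≤ P * d)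
    (μ : Measure (Matrix.unitaryGroup (Fin P × Fin d) ℂ)) [IsProbabilityMeasure μ]
    [μ.IsMulRightInvariant] (A : Matrix (Fin P × Fin d) (Fin P × Fin d) ℂ) :
    ∫ U, ‖trace (Q (M0 P d hP) U * A) - trace A‖ ^ 2 ∂μ ≤ 1 / d * fro A := by
  obtain ⟨a, b, hab⟩ : ∃ a b : Fin P × Fin d, a ≠ b := by
    have : 1 < Fintype.card (Fin P × Fin d) := by simp; omega
    exact Fintype.exists_pair_of_one_lt_card this
  set M := M0 P d hP with hM0
  have hM : M.IsHermitian := M0_herm P d hP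
  have hP0 : (P : ℂ) ≠ 0 := by exact_mod_cast hP.ne'
  have hd0 : (d : ℂ) ≠ 0 := by exact_mod_cast hd.ne'
  set t : ℂ := trace A / (P * d) with ht
  have htA : t * (P * d) = trace A := by rw [ht]; field_simp
  set A0 := A - t • (1 : Matrix (Fin P × Fin d) (Fin P × Fin d) ℂ) with hA0
  have htr : trace A0 = 0 := by
    rw [hA0, trace_sub, trace_smul, trace_one, ← htA]
    simp
  have h1 : ∀ U, trace (Q M U * A) - trace A = trace (Q M U * A0) := by
    intro U
    rw [hA0, mul_sub, trace_sub, mul_smul_comm, mul_one, trace_smul, Q_trace, M0_trace, ← htA,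
      smul_eq_mul]
  have h2 : fro A0 ≤ fro A := by
    have hA : A = A0 + t • 1 := by rw [hA0]; simp
    have htr' : trace A0ᴴ = 0 := by rw [trace_conjTranspose, htr, star_zero]
    have : fro A = fro A0 + ‖t‖ ^ 2 * (P * d) := by
      conv_lhs => rw [hA]
      simp only [fro, conjTranspose_add, conjTranspose_smul, conjTranspose_one, add_mul, mul_add,
        trace_add, smul_mul_assoc, mul_smul_comm, trace_smul, mul_one, one_mul, htr, htr',
        trace_one]
      rw [← Complex.normSq_eq_norm_sq, Complex.normSq_apply]
      simp
      ring
    rw [this]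
    have : 0 ≤ ‖t‖ ^ 2 * ((P : ℝ) * d) := by positivity
    linarith
  have h0 : 0 ≤ fro A0 := by rw [fro_eq]; positivity
  simp only [h1]
  change T μ M A0 ≤ _
  rw [T_gen μ hM hab htr]
  have h3 := c_bound P d hP hd hD μ hab
  calc _ ≤ 1 / (d : ℝ) * fro A0 := by gcongr
    _ ≤ _ := by gcongr

lemma slice_trace (P d m : ℕ) (hP : 0 < P) (U : Matrix.unitaryGroup (Fin P × Fin d) ℂ)
    (ψ₁ ψ₂ : (Fin P × Fin d) × Fin m → ℂ) :
    inn (sliceV P d m hP U ψ₁) (sliceV P d m hP U ψ₂)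
      = trace (Q (M0 P d hP) U * ((Matrix.of fun x y => ψ₂ (x, y)) *
          (Matrix.of fun x y => ψ₁ (x, y))ᴴ)) := by
  set B : Matrix (Fin d) (Fin P × Fin d) ℂ := Matrix.of fun j x =>
    (U : Matrix (Fin P × Fin d) (Fin P × Fin d) ℂ) (⟨0, hP⟩, j) x with hB
  set X₁ : Matrix (Fin P × Fin d) (Fin m) ℂ := Matrix.of fun x y => ψ₁ (x, y) with hX₁
  set X₂ : Matrix (Fin P × Fin d) (Fin m) ℂ := Matrix.of fun x y => ψ₂ (x, y) with hX₂
  have hQ : Q (M0 P d hP) U = (P : ℂ) • (Bᴴ * B) := by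
    ext x x'
    rw [Q, M0, mul_apply, Matrix.smul_apply, mul_apply, smul_eq_mul, Finset.mul_sum,
      Fintype.sum_prod_type]
    simp only [mul_diagonal, conjTranspose_apply, hB, of_apply]
    rw [Finset.sum_eq_single (⟨0, hP⟩ : Fin P)]
    · simp only [if_true]
      refine Finset.sum_congr rfl fun j _ => by ring
    · intro i _ hi; simp [hi]
    · simp
  have h1 : trace ((Bᴴ * B) * (X₂ * X₁ᴴ)) = trace ((B * X₁)ᴴ * (B * X₂)) := by
    rw [conjTranspose_mul, ← Matrix.mul_assoc, trace_mul_comm]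
    simp only [Matrix.mul_assoc]
  have hsq : (Real.sqrt P : ℂ) * (Real.sqrt P : ℂ) = P := by
    rw [← Complex.ofReal_mul, Real.mul_self_sqrt (by positivity)]; simp
  rw [hQ, smul_mul_assoc, trace_smul, h1, smul_eq_mul, ← hsq]
  have hs : ∀ (ψ : (Fin P × Fin d) × Fin m → ℂ) j y, sliceV P d m hP U ψ (j, y)
      = (Real.sqrt P : ℂ) * (B * Matrix.of fun x y => ψ (x, y)) j y := by
    intro ψ j y
    simp [sliceV, mul_apply, hB]
  simp only [inn, Fintype.sum_prod_type_right, hs, trace, diag_apply]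
  rw [Finset.mul_sum]
  refine Finset.sum_congr rfl fun y _ => ?_
  rw [mul_apply, Finset.mul_sum]
  refine Finset.sum_congr rfl fun j _ => ?_
  rw [conjTranspose_apply, map_mul, Complex.conj_ofReal]
  simp only [starRingEnd_apply]
  ring

lemma fro_outer {m : Type*} [Fintype m] (ψ₁ ψ₂ : n × m → ℂ) :
    fro ((Matrix.of fun x y => ψ₂ (x, y)) * (Matrix.of fun x y => ψ₁ (x, y))ᴴ)
      ≤ nrm ψ₁ * nrm ψ₂ := by
  rw [fro_eq, mul_comm]
  simp only [nrm, Fintype.sum_prod_type]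
  rw [Finset.sum_mul_sum]
  refine Finset.sum_le_sum fun i _ => Finset.sum_le_sum fun j _ => ?_
  rw [mul_apply]
  calc _ ≤ (∑ y, ‖ψ₂ (i, y)‖ * ‖ψ₁ (j, y)‖) ^ 2 := by
        gcongr
        refine (norm_sum_le _ _).trans (le_of_eq ?_)
        simp
    _ ≤ _ := Finset.sum_mul_sq_le_sq_mul_sq _ _ _

lemma slice_cont (P d m : ℕ) (hP : 0 < P) (ψ₁ ψ₂ : (Fin P × Fin d) × Fin m → ℂ) :
    Continuous fun U => inn (sliceV P d m hP U ψ₁) (sliceV P d m hP U ψ₂) := by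
  simp only [slice_trace]
  have := Q_cont (M0 P d hP)
  fun_prop

lemma single_layer (P d m : ℕ) (hP : 0 < P) (hd : 0 < d) (hD : 2 ≤ P * d)
    (μ : Measure (Matrix.unitaryGroup (Fin P × Fin d) ℂ)) [IsProbabilityMeasure μ]
    [μ.IsMulRightInvariant] (ψ₁ ψ₂ : (Fin P × Fin d) × Fin m → ℂ) :
    ∫ U, ‖inn (sliceV P d m hP U ψ₁) (sliceV P d m hP U ψ₂) - inn ψ₁ ψ₂‖ ^ 2 ∂μ
      ≤ 1 / d * (nrm ψ₁ * nrm ψ₂) := by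
  have h := mat_bound P d hP hd hD μ ((Matrix.of fun x y => ψ₂ (x, y)) *
          (Matrix.of fun x y => ψ₁ (x, y))ᴴ)
  have ht : trace ((Matrix.of fun x y => ψ₂ (x, y)) * (Matrix.of fun x y => ψ₁ (x, y))ᴴ)
      = inn ψ₁ ψ₂ := by
    simp only [trace, diag_apply, mul_apply, conjTranspose_apply, of_apply, inn,
      Fintype.sum_prod_type]
    refine Finset.sum_congr rfl fun i _ => Finset.sum_congr rfl fun j _ =>
      Finset.sum_congr rfl fun k _ => ?_
    rw [mul_comm]; rfl
  rw [ht] at h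
  simp only [slice_trace]
  refine h.trans ?_
  gcongr
  exact fro_outer ψ₁ ψ₂

end TL

/-- **Two-layer composition bound.**  Assume `P₁d₁ ≥ 2`, `P₂d₂ ≥ 2` and
`d₂·m₂ = P₁·d₁·m₁`, and fix a unitary (inner-product preserving linear) isomorphism
`ι : ℂ^{d₂} ⊗ ℂ^{m₂} ≃ ℂ^{P₁d₁} ⊗ ℂ^{m₁}`.  Let `V(U₁, U₂) = V₁(U₁) ∘ ι ∘ V₂(U₂)` be the
two-layer slice-normal network, with `U₁, U₂` independent Haar-random unitaries (drawn from
the Haar probability measures `μ₁, μ₂`, i.e. the left- and right-invariant Borel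
probability measures on `U(P₁d₁)` and `U(P₂d₂)`).  Then for all unit vectors
`ψ₁, ψ₂ ∈ ℂ^{P₂d₂} ⊗ ℂ^{m₂}`,
`∫∫ |⟨ψ₁, V(U₁,U₂)†V(U₁,U₂) ψ₂⟩ − ⟨ψ₁, ψ₂⟩|² dμ₁(U₁) dμ₂(U₂) ≤ 8·(1/d₁ + 1/d₂)`. -/
theorem sliceV_two_layer_bound (P₁ d₁ m₁ P₂ d₂ m₂ : ℕ)
    (hP₁ : 0 < P₁) (hd₁ : 0 < d₁) (hm₁ : 0 < m₁)
    (hP₂ : 0 < P₂) (hd₂ : 0 < d₂) (hm₂ : 0 < m₂)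
    (hP₁d₁ : 2 ≤ P₁ * d₁) (hP₂d₂ : 2 ≤ P₂ * d₂)
    (hdim : d₂ * m₂ = P₁ * d₁ * m₁)
    (e : (Fin d₂ × Fin m₂ → ℂ) ≃ₗ[ℂ] ((Fin P₁ × Fin d₁) × Fin m₁ → ℂ))
    (he : ∀ f g : Fin d₂ × Fin m₂ → ℂ, inn (e f) (e g) = inn f g)
    (μ₁ : Measure (Matrix.unitaryGroup (Fin P₁ × Fin d₁) ℂ))
    (μ₂ : Measure (Matrix.unitaryGroup (Fin P₂ × Fin d₂) ℂ))
    [IsProbabilityMeasure μ₁] [μ₁.IsMulLeftInvariant] [μ₁.IsMulRightInvariant]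
    [IsProbabilityMeasure μ₂] [μ₂.IsMulLeftInvariant] [μ₂.IsMulRightInvariant]
    (ψ₁ ψ₂ : (Fin P₂ × Fin d₂) × Fin m₂ → ℂ)
    (hψ₁ : inn ψ₁ ψ₁ = 1) (hψ₂ : inn ψ₂ ψ₂ = 1) :
    ∫ U₂, ∫ U₁,
        ‖inn (sliceV P₁ d₁ m₁ hP₁ U₁ (e (sliceV P₂ d₂ m₂ hP₂ U₂ ψ₁)))
             (sliceV P₁ d₁ m₁ hP₁ U₁ (e (sliceV P₂ d₂ m₂ hP₂ U₂ ψ₂)))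
          - inn ψ₁ ψ₂‖ ^ 2 ∂μ₁ ∂μ₂
      ≤ 8 * (1 / (d₁ : ℝ) + 1 / (d₂ : ℝ)) := by
  have hd₁' : (1 : ℝ) ≤ d₁ := by exact_mod_cast hd₁
  have hd₂' : (1 : ℝ) ≤ d₂ := by exact_mod_cast hd₂
  have hn₁ : TL.nrm ψ₁ = 1 := by
    rw [TL.inn_self] at hψ₁; exact_mod_cast hψ₁
  have hn₂ : TL.nrm ψ₂ = 1 := by
    rw [TL.inn_self] at hψ₂; exact_mod_cast hψ₂
  have hen : ∀ f, TL.nrm (e f) = TL.nrm f := by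
    intro f
    have := he f f
    rw [TL.inn_self, TL.inn_self] at this
    exact_mod_cast this
  -- norm deviations of the second layer
  let g : ((Fin P₂ × Fin d₂) × Fin m₂ → ℂ) → ((Fin P₂ × Fin d₂) × Fin m₂ → ℂ) →
      Matrix.unitaryGroup (Fin P₂ × Fin d₂) ℂ → ℝ := fun φ χ U =>
    ‖inn (sliceV P₂ d₂ m₂ hP₂ U φ) (sliceV P₂ d₂ m₂ hP₂ U χ) - inn φ χ‖ ^ 2
  have hgc : ∀ φ χ, Continuous (g φ χ) := by
    intro φ χ
    have := TL.slice_cont P₂ d₂ m₂ hP₂ φ χ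
    fun_prop
  have hgi : ∀ φ χ, Integrable (g φ χ) μ₂ := fun φ χ => TL.intg μ₂ (hgc φ χ)
  have hgb : ∀ φ χ, ∫ U, g φ χ U ∂μ₂ ≤ 1 / d₂ * (TL.nrm φ * TL.nrm χ) := fun φ χ =>
    TL.single_layer P₂ d₂ m₂ hP₂ hd₂ hP₂d₂ μ₂ φ χ
  have hinner : ∀ U₂, ∫ U₁,
        ‖inn (sliceV P₁ d₁ m₁ hP₁ U₁ (e (sliceV P₂ d₂ m₂ hP₂ U₂ ψ₁)))
             (sliceV P₁ d₁ m₁ hP₁ U₁ (e (sliceV P₂ d₂ m₂ hP₂ U₂ ψ₂)))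
          - inn ψ₁ ψ₂‖ ^ 2 ∂μ₁
      ≤ 2 / d₁ * (g ψ₁ ψ₁ U₂ + g ψ₂ ψ₂ U₂ + 2) + 2 * g ψ₁ ψ₂ U₂ := by
    intro U₂
    set φ₁ := sliceV P₂ d₂ m₂ hP₂ U₂ ψ₁ with hφ₁
    set φ₂ := sliceV P₂ d₂ m₂ hP₂ U₂ ψ₂ with hφ₂
    have hc := TL.slice_cont P₁ d₁ m₁ hP₁ (e φ₁) (e φ₂)
    have hb := TL.single_layer P₁ d₁ m₁ hP₁ hd₁ hP₁d₁ μ₁ (e φ₁) (e φ₂)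
    rw [he, hen, hen] at hb
    have hg1 : g ψ₁ ψ₁ U₂ = (TL.nrm φ₁ - 1) ^ 2 := by
      simp only [g]
      rw [← hφ₁, hψ₁, TL.inn_self, ← Complex.ofReal_one, ← Complex.ofReal_sub, Complex.norm_real,
        Real.norm_eq_abs, sq_abs]
    have hg2 : g ψ₂ ψ₂ U₂ = (TL.nrm φ₂ - 1) ^ 2 := by
      simp only [g]
      rw [← hφ₂, hψ₂, TL.inn_self, ← Complex.ofReal_one, ← Complex.ofReal_sub, Complex.norm_real,
        Real.norm_eq_abs, sq_abs]
    have hN : TL.nrm φ₁ * TL.nrm φ₂ ≤ g ψ₁ ψ₁ U₂ + g ψ₂ ψ₂ U₂ + 2 := by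
      rw [hg1, hg2]
      nlinarith [sq_nonneg (TL.nrm φ₁ - TL.nrm φ₂), sq_nonneg (TL.nrm φ₁ - 2),
        sq_nonneg (TL.nrm φ₂ - 2)]
    have hpt : ∀ z : ℂ, ‖z - inn ψ₁ ψ₂‖ ^ 2 ≤ 2 * ‖z - inn φ₁ φ₂‖ ^ 2 + 2 * g ψ₁ ψ₂ U₂ := by
      intro z
      have h1 : ‖z - inn ψ₁ ψ₂‖ ≤ ‖z - inn φ₁ φ₂‖ + ‖inn φ₁ φ₂ - inn ψ₁ ψ₂‖ :=
        norm_sub_le_norm_sub_add_norm_sub _ _ _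
      have h2 : g ψ₁ ψ₂ U₂ = ‖inn φ₁ φ₂ - inn ψ₁ ψ₂‖ ^ 2 := rfl
      rw [h2]
      have h3 := norm_nonneg (z - inn ψ₁ ψ₂)
      nlinarith [sq_nonneg (‖z - inn φ₁ φ₂‖ - ‖inn φ₁ φ₂ - inn ψ₁ ψ₂‖)]
    have hi1 : Integrable (fun U₁ => ‖inn (sliceV P₁ d₁ m₁ hP₁ U₁ (e φ₁))
        (sliceV P₁ d₁ m₁ hP₁ U₁ (e φ₂)) - inn φ₁ φ₂‖ ^ 2) μ₁ := TL.intg μ₁ (by fun_prop)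
    calc _ ≤ ∫ U₁, (2 * ‖inn (sliceV P₁ d₁ m₁ hP₁ U₁ (e φ₁))
              (sliceV P₁ d₁ m₁ hP₁ U₁ (e φ₂)) - inn φ₁ φ₂‖ ^ 2 + 2 * g ψ₁ ψ₂ U₂) ∂μ₁ := by
          refine integral_mono (TL.intg μ₁ (by fun_prop)) ((hi1.const_mul 2).add
            (integrable_const _)) fun U₁ => hpt _
      _ = 2 * (∫ U₁, ‖inn (sliceV P₁ d₁ m₁ hP₁ U₁ (e φ₁))
              (sliceV P₁ d₁ m₁ hP₁ U₁ (e φ₂)) - inn φ₁ φ₂‖ ^ 2 ∂μ₁) + 2 * g ψ₁ ψ₂ U₂ := by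
          rw [integral_add (hi1.const_mul 2) (integrable_const _), integral_const_mul]
          simp
      _ ≤ 2 * (1 / d₁ * (g ψ₁ ψ₁ U₂ + g ψ₂ ψ₂ U₂ + 2)) + 2 * g ψ₁ ψ₂ U₂ := by
          have : 1 / (d₁ : ℝ) * (TL.nrm φ₁ * TL.nrm φ₂)
            ≤ 1 / d₁ * (g ψ₁ ψ₁ U₂ + g ψ₂ ψ₂ U₂ + 2) := by gcongr
          linarith
      _ = _ := by ring
  have hi2 : Integrable (fun U₂ => g ψ₁ ψ₁ U₂ + g ψ₂ ψ₂ U₂ + 2) μ₂ :=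
    ((hgi ψ₁ ψ₁).add (hgi ψ₂ ψ₂)).add (integrable_const _)
  have hb11 := hgb ψ₁ ψ₁
  have hb22 := hgb ψ₂ ψ₂
  have hb12 := hgb ψ₁ ψ₂
  rw [hn₁] at hb11 hb12
  rw [hn₂] at hb22 hb12
  have hd2le : 1 / (d₂ : ℝ) ≤ 1 := by
    rw [div_le_one (by linarith)]; exact hd₂'
  calc _ ≤ ∫ U₂, (2 / d₁ * (g ψ₁ ψ₁ U₂ + g ψ₂ ψ₂ U₂ + 2) + 2 * g ψ₁ ψ₂ U₂) ∂μ₂ := by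
        refine integral_mono_of_nonneg (Filter.Eventually.of_forall fun U₂ =>
          integral_nonneg fun U₁ => by positivity) ((hi2.const_mul _).add ((hgi ψ₁ ψ₂).const_mul _))
          (Filter.Eventually.of_forall hinner)
    _ = 2 / d₁ * ((∫ U, g ψ₁ ψ₁ U ∂μ₂) + (∫ U, g ψ₂ ψ₂ U ∂μ₂) + 2)
          + 2 * ∫ U, g ψ₁ ψ₂ U ∂μ₂ := by
        rw [integral_add (hi2.const_mul _) ((hgi ψ₁ ψ₂).const_mul _), integral_const_mul,
          integral_const_mul, integral_add (f := fun U => g ψ₁ ψ₁ U + g ψ₂ ψ₂ U)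
            ((hgi ψ₁ ψ₁).add (hgi ψ₂ ψ₂)) (integrable_const _),
          integral_add (hgi ψ₁ ψ₁) (hgi ψ₂ ψ₂)]
        simp
    _ ≤ 2 / d₁ * (1 + 1 + 2) + 2 * (1 / d₂) := by
        gcongr <;> linarith
    _ ≤ _ := by
        have h1 : 0 ≤ 1 / (d₂ : ℝ) := by positivity
        have h2 : 2 / (d₁ : ℝ) * (1 + 1 + 2) = 8 * (1 / d₁) := by ring
        rw [h2]; linarith
end

section
/- Single-layer form of the main theorem (equivalence of emergence with superpolynomial χ-entropy): let P, d, m : ℕ → ℕ be sequences with P_N ≥ 2, d_N ≥ 1 and m_N ≥ 1 for all N, and for each N let V_N(U) be the single-layer slice-normal map with parameters (P_N, d_N, m_N). The following are equivalent: (a) for every α > 0 there is a constant C such that for all N ≥ 1 and all unit vectors ψ₁, ψ₂ ∈ ℂ^{P_N d_N} ⊗ ℂ^{m_N}, ∫ |⟨ψ₁, V_N(U)†V_N(U) ψ₂⟩ − ⟨ψ₁, ψ₂⟩|² dμ_N(U) ≤ C · N^{−α}; (b) for every α > 0 there is a constant C such that (P_N − 1)/(P_N d_N + 1) ≤ C ·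 N^{−α} for all N ≥ 1; (c) for every k ∈ ℕ, N^k / d_N → 0 as N → ∞. -/
open MeasureTheory ComplexConjugate
open scoped Matrix

section helper
variable {ι : Type*} [Fintype ι] [DecidableEq ι]

instance slCompact : CompactSpace (Matrix.unitaryGroup ι ℂ) := by
  refine (isCompact_iff_compactSpace (s := (Matrix.unitaryGroup ι ℂ : Set (Matrix ι ι ℂ)))).1 ?_
  have hK : IsCompact (Set.pi Set.univ (fun _ : ι => Set.pi Set.univ
      (fun _ : ι => Metric.closedBall (0 : ℂ) 1))) :=
    isCompact_univ_pi fun _ => isCompact_univ_pi fun _ => isCompact_closedBall _ _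
  refine IsCompact.of_isClosed_subset hK ?_ ?_
  · have : (Matrix.unitaryGroup ι ℂ : Set (Matrix ι ι ℂ)) = {M | M * star M = 1} := by
      ext M; exact Matrix.mem_unitaryGroup_iff
    rw [this]
    exact isClosed_eq (continuous_id.mul continuous_star) continuous_const
  · intro M hM i _ j _
    rw [mem_closedBall_zero_iff]
    exact entry_norm_bound_of_unitary hM i j

lemma slInt {E : Type*} [NormedAddCommGroup E] [SecondCountableTopologyEither (Matrix.unitaryGroup ι ℂ) E]
    (μ : Measure (Matrix.unitaryGroup ι ℂ)) [IsProbabilityMeasure μ]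
    {g : Matrix.unitaryGroup ι ℂ → E} (hg : Continuous g) : Integrable g μ :=
  hg.integrable_of_hasCompactSupport (HasCompactSupport.of_compactSpace g)

/-- conjugated matrix -/
noncomputable def slA (T : Matrix ι ι ℂ) (U : Matrix.unitaryGroup ι ℂ) : Matrix ι ι ℂ :=
  star (U : Matrix ι ι ℂ) * T * (U : Matrix ι ι ℂ)

lemma slA_cont (T : Matrix ι ι ℂ) : Continuous (slA T) := by
  unfold slA
  exact ((continuous_star.comp continuous_subtype_val).mul continuous_const).mul
    continuous_subtype_val

lemma slA_cont_entry (T : Matrix ι ι ℂ) (a b : ι) : Continuous (fun U => slA T U a b) :=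
  (slA_cont T).matrix_elem a b

lemma slA_mul (T : Matrix ι ι ℂ) (U W : Matrix.unitaryGroup ι ℂ) :
    slA T (U * W) = star (W : Matrix ι ι ℂ) * slA T U * (W : Matrix ι ι ℂ) := by
  simp [slA, Matrix.mul_assoc]

lemma slA_trace (T : Matrix ι ι ℂ) (U : Matrix.unitaryGroup ι ℂ) :
    (slA T U).trace = T.trace := by
  rw [slA, Matrix.trace_mul_comm, ← Matrix.mul_assoc, Matrix.mem_unitaryGroup_iff.1 U.2,
    Matrix.one_mul]

lemma slA_frob (T : Matrix ι ι ℂ) (U : Matrix.unitaryGroup ι ℂ) :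
    ∑ a, ∑ b, ‖slA T U a b‖ ^ 2 = ((T * star T).trace).re := by
  have h1 : (slA T U * star (slA T U)).trace = (T * star T).trace := by
    have : slA T U * star (slA T U) = slA (T * star T) U := by
      have h := Matrix.mem_unitaryGroup_iff.1 U.2
      simp only [slA, star_mul, star_star]
      calc _ = star (U : Matrix ι ι ℂ) * T * ((U : Matrix ι ι ℂ) * star (U : Matrix ι ι ℂ))
            * star T * U := by simp only [Matrix.mul_assoc]
        _ = _ := by rw [h]; simp only [Matrix.mul_assoc, Matrix.one_mul]
    rw [this, slA_trace]
  rw [← h1, Matrix.trace]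
  simp only [Matrix.diag_apply, Matrix.mul_apply, Matrix.star_apply, Complex.re_sum]
  refine Finset.sum_congr rfl fun a _ => Finset.sum_congr rfl fun b _ => ?_
  have := Complex.mul_conj (slA T U a b)
  rw [Complex.star_def, this, Complex.normSq_eq_norm_sq, Complex.ofReal_re]

/-- second moment -/
noncomputable def slF (T : Matrix ι ι ℂ) (μ : Measure (Matrix.unitaryGroup ι ℂ))
    (M : Matrix ι ι ℂ) : ℝ := ∫ U, ‖(slA T U * M).trace‖ ^ 2 ∂μ

lemma slF_cont (T M : Matrix ι ι ℂ) : Continuous (fun U => ‖(slA T U * M).trace‖ ^ 2) :=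
  (((slA_cont T).mul continuous_const).matrix_trace.norm.pow 2)

lemma slF_conj (T : Matrix ι ι ℂ) (μ : Measure (Matrix.unitaryGroup ι ℂ))
    [μ.IsMulRightInvariant] (M : Matrix ι ι ℂ) (W : Matrix.unitaryGroup ι ℂ) :
    slF T μ ((W : Matrix ι ι ℂ) * M * star (W : Matrix ι ι ℂ)) = slF T μ M := by
  unfold slF
  rw [← integral_mul_right_eq_self (fun U => ‖(slA T U * M).trace‖ ^ 2) W]
  congr 1; ext U
  congr 2
  rw [slA_mul, ← Matrix.mul_assoc, Matrix.trace_mul_comm, ← Matrix.mul_assoc, ← Matrix.mul_assoc]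

lemma slF_add_le (T : Matrix ι ι ℂ) (μ : Measure (Matrix.unitaryGroup ι ℂ))
    [IsProbabilityMeasure μ] (M M' : Matrix ι ι ℂ) :
    slF T μ (M + M') ≤ 2 * (slF T μ M + slF T μ M') := by
  unfold slF
  rw [← integral_add (slInt μ (slF_cont T M)) (slInt μ (slF_cont T M')), ← integral_const_mul]
  refine integral_mono (slInt μ (slF_cont T _))
    (slInt μ (((slF_cont T M).add (slF_cont T M')).const_mul 2)) fun U => ?_
  simp only [Matrix.mul_add, Matrix.trace_add]
  have := norm_add_le (slA T U * M).trace (slA T U * M').trace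
  have h0 := norm_nonneg ((slA T U * M).trace + (slA T U * M').trace)
  nlinarith [sq_nonneg (‖(slA T U * M).trace‖ - ‖(slA T U * M').trace‖)]

lemma slF_smul (T : Matrix ι ι ℂ) (μ : Measure (Matrix.unitaryGroup ι ℂ))
    (c : ℂ) (M : Matrix ι ι ℂ) : slF T μ (c • M) = ‖c‖ ^ 2 * slF T μ M := by
  unfold slF
  rw [← integral_const_mul]
  congr 1; ext U
  simp [mul_pow]

lemma slF_single (T : Matrix ι ι ℂ) (μ : Measure (Matrix.unitaryGroup ι ℂ)) (a b : ι) :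
    slF T μ (Matrix.single a b 1) = ∫ U, ‖slA T U b a‖ ^ 2 ∂μ := by
  unfold slF
  congr 1; ext U
  rw [Matrix.trace_mul_single]; simp

/-- diagonal covariance -/
noncomputable def slB (T : Matrix ι ι ℂ) (μ : Measure (Matrix.unitaryGroup ι ℂ)) (a b : ι) : ℝ :=
  ∫ U, (slA T U a a * conj (slA T U b b)).re ∂μ

lemma slB_cont (T : Matrix ι ι ℂ) (a b : ι) :
    Continuous (fun U => (slA T U a a * conj (slA T U b b)).re) :=
  Complex.continuous_re.comp ((slA_cont_entry T a a).mul
    (Complex.continuous_conj.comp (slA_cont_entry T b b)))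

lemma slB_perm (T : Matrix ι ι ℂ) (μ : Measure (Matrix.unitaryGroup ι ℂ))
    [μ.IsMulRightInvariant] (σ : Equiv.Perm ι) (a b : ι) :
    slB T μ (σ a) (σ b) = slB T μ a b := by
  have hW : (σ⁻¹).permMatrix ℂ ∈ Matrix.unitaryGroup ι ℂ := by
    rw [Matrix.mem_unitaryGroup_iff, Matrix.star_eq_conjTranspose, Matrix.conjTranspose_permMatrix,
      ← Matrix.permMatrix_mul]
    simp
  have key : ∀ U a, slA T (U * ⟨_, hW⟩) a a = slA T U (σ a) (σ a) := by
    intro U a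
    rw [slA_mul]
    simp only [Matrix.star_eq_conjTranspose, Matrix.conjTranspose_permMatrix]
    rw [Equiv.Perm.permMatrix, Equiv.Perm.permMatrix, PEquiv.mul_toMatrix_toPEquiv,
      PEquiv.toMatrix_toPEquiv_mul]
    simp [Equiv.Perm.inv_def]
  unfold slB
  rw [← integral_mul_right_eq_self (fun U => (slA T U a a * conj (slA T U b b)).re) ⟨_, hW⟩]
  simp only [key]

lemma slB_sum (T : Matrix ι ι ℂ) (hT : T.trace = 0) (μ : Measure (Matrix.unitaryGroup ι ℂ))
    [IsProbabilityMeasure μ] (a : ι) : ∑ b, slB T μ a b = 0 := by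
  unfold slB
  rw [← integral_finsetSum _ fun b _ => slInt μ (slB_cont T a b)]
  have : ∀ U, ∑ b, (slA T U a a * conj (slA T U b b)).re = 0 := by
    intro U
    rw [← Complex.re_sum, ← Finset.mul_sum, ← map_sum]
    have := slA_trace T U
    rw [hT, Matrix.trace] at this
    simp only [Matrix.diag_apply] at this
    simp [this]
  simp only [this, integral_zero]

lemma slF_diag (T : Matrix ι ι ℂ) (μ : Measure (Matrix.unitaryGroup ι ℂ))
    [IsProbabilityMeasure μ] (l : ι → ℝ) :
    slF T μ (Matrix.diagonal fun i => (l i : ℂ)) = ∑ a, ∑ b, l a * l b * slB T μ a b := by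
  unfold slF slB
  simp only [← integral_const_mul]
  have : ∀ U, ‖(slA T U * Matrix.diagonal fun i => (l i : ℂ)).trace‖ ^ 2 =
      ∑ a, ∑ b, l a * l b * (slA T U a a * conj (slA T U b b)).re := by
    intro U
    rw [← Complex.normSq_eq_norm_sq, ← Complex.ofReal_re (Complex.normSq _), ← Complex.mul_conj]
    simp only [Matrix.trace, Matrix.diag_apply, Matrix.mul_diagonal, map_sum, Finset.sum_mul_sum,
      Complex.re_sum]
    refine Finset.sum_congr rfl fun a _ => Finset.sum_congr rfl fun b _ => ?_
    rw [map_mul, Complex.conj_ofReal, ← Complex.re_ofReal_mul]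
    congr 1; push_cast; ring
  simp only [this]
  rw [integral_finsetSum _ fun a _ => slInt μ (continuous_finsetSum _ fun b _ =>
    (slB_cont T a b).const_mul _)]
  refine Finset.sum_congr rfl fun a _ => ?_
  rw [integral_finsetSum _ fun b _ => slInt μ ((slB_cont T a b).const_mul _)]

lemma slB_struct [Nontrivial ι] (T : Matrix ι ι ℂ) (hT : T.trace = 0)
    (μ : Measure (Matrix.unitaryGroup ι ℂ))
    [IsProbabilityMeasure μ] [μ.IsMulRightInvariant] :
    ∃ s r : ℝ, r ≤ 0 ∧ ∀ a b, slB T μ a b = (if a = b then s else 0) + r := by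
  obtain ⟨x, y, hxy⟩ := exists_pair_ne ι
  have hd : ∀ a, slB T μ a a = slB T μ x x := by
    intro a
    have := slB_perm T μ (Equiv.swap x a) x x
    simpa using this
  have ho : ∀ a b, a ≠ b → slB T μ a b = slB T μ x y := by
    intro a b hab
    by_cases h : y = a
    · subst h
      have := slB_perm T μ (Equiv.swap x b * Equiv.swap x y) x y
      simp only [Equiv.Perm.mul_apply, Equiv.swap_apply_left, Equiv.swap_apply_right] at this
      rwa [Equiv.swap_apply_of_ne_of_ne hxy.symm hab] at this
    · have := slB_perm T μ (Equiv.swap (Equiv.swap x a y) b * Equiv.swap x a) x y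
      simp only [Equiv.Perm.mul_apply, Equiv.swap_apply_left] at this
      have h2 : Equiv.swap x a y = y := Equiv.swap_apply_of_ne_of_ne hxy.symm h
      rw [h2] at this
      rw [Equiv.swap_apply_of_ne_of_ne (Ne.symm h) hab] at this
      exact this
  have hq : 0 ≤ slB T μ x x := by
    unfold slB
    refine integral_nonneg fun U => ?_
    simp only [Pi.zero_apply, Complex.mul_conj, Complex.ofReal_re]
    exact Complex.normSq_nonneg _
  have hs := slB_sum T hT μ x
  rw [← Finset.add_sum_erase _ _ (Finset.mem_univ x), Finset.sum_congr rfl (g := fun _ => slB T μ x y)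
    (fun b hb => ho x b (Finset.ne_of_mem_erase hb).symm), Finset.sum_const, nsmul_eq_mul] at hs
  have hc : (0 : ℝ) < ((Finset.univ.erase x).card : ℝ) := by
    exact_mod_cast Finset.card_pos.2 ⟨y, by simp [hxy.symm]⟩
  refine ⟨slB T μ x x - slB T μ x y, slB T μ x y, ?_, ?_⟩
  · by_contra h
    push Not at h
    nlinarith [mul_pos hc h]
  · intro a b
    by_cases h : a = b
    · subst h; simp [hd a]
    · simp [h, ho a b h]

lemma slF_herm (T : Matrix ι ι ℂ)
    (μ : Measure (Matrix.unitaryGroup ι ℂ))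
    [IsProbabilityMeasure μ] [μ.IsMulRightInvariant] (s r : ℝ)
    (h : ∀ a b, slB T μ a b = (if a = b then s else 0) + r) (H : Matrix ι ι ℂ)
    (hH : H.IsHermitian) :
    slF T μ H = s * ((H * H).trace).re + r * (H.trace.re) ^ 2 := by
  have hsp : H = (hH.eigenvectorUnitary : Matrix ι ι ℂ) *
      (Matrix.diagonal fun i => (hH.eigenvalues i : ℂ)) *
      star (hH.eigenvectorUnitary : Matrix ι ι ℂ) := by
    have := hH.spectral_theorem
    rw [Unitary.conjStarAlgAut_apply] at this
    exact this
  have hW := Matrix.mem_unitaryGroup_iff'.1 hH.eigenvectorUnitary.2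
  generalize hH.eigenvectorUnitary = W at hsp hW
  generalize hH.eigenvalues = l at hsp
  have h1 : H.trace = ∑ i, (l i : ℂ) := by
    rw [hsp, Matrix.trace_mul_comm, ← Matrix.mul_assoc, hW, Matrix.one_mul, Matrix.trace_diagonal]
  have h2 : (H * H).trace = ∑ i, (l i : ℂ) * (l i : ℂ) := by
    have : H * H = (W : Matrix ι ι ℂ) * ((Matrix.diagonal fun i => (l i : ℂ)) *
        (Matrix.diagonal fun i => (l i : ℂ))) * star (W : Matrix ι ι ℂ) := by
      conv_lhs => rw [hsp]
      calc _ = (W : Matrix ι ι ℂ) * (Matrix.diagonal fun i => (l i : ℂ)) *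
            (star (W : Matrix ι ι ℂ) * W) *
            (Matrix.diagonal fun i => (l i : ℂ)) * star (W : Matrix ι ι ℂ) := by
              simp only [Matrix.mul_assoc]
        _ = _ := by rw [hW]; simp only [Matrix.mul_assoc, Matrix.one_mul]
    rw [this, Matrix.trace_mul_comm, ← Matrix.mul_assoc, hW, Matrix.one_mul,
      Matrix.diagonal_mul_diagonal, Matrix.trace_diagonal]
  rw [h1, h2]
  conv_lhs => rw [hsp]
  rw [slF_conj, slF_diag]
  simp only [h, mul_add, Finset.sum_add_distrib, mul_ite, mul_zero, Finset.sum_ite_eq,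
    Finset.mem_univ, if_true, Complex.re_sum, Complex.ofReal_re, ← Complex.ofReal_mul]
  rw [sq, Finset.sum_mul_sum, Finset.mul_sum, Finset.mul_sum]
  congr 1
  · exact Finset.sum_congr rfl fun a _ => by ring
  · refine Finset.sum_congr rfl fun a _ => ?_
    rw [Finset.mul_sum]
    exact Finset.sum_congr rfl fun a _ => by ring

lemma slF_nonneg (T : Matrix ι ι ℂ) (μ : Measure (Matrix.unitaryGroup ι ℂ))
    (M : Matrix ι ι ℂ) : 0 ≤ slF T μ M :=
  integral_nonneg fun U => by positivity

lemma slF_sum_single (T : Matrix ι ι ℂ) (μ : Measure (Matrix.unitaryGroup ι ℂ))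
    [IsProbabilityMeasure μ] :
    ∑ a, ∑ b, slF T μ (Matrix.single b a 1) = ((T * star T).trace).re := by
  have hc : ∀ a b, Continuous (fun U => ‖slA T U a b‖ ^ 2) :=
    fun a b => (slA_cont_entry T a b).norm.pow 2
  have : ∫ U, ∑ a, ∑ b, ‖slA T U a b‖ ^ 2 ∂μ = ((T * star T).trace).re := by
    simp only [slA_frob]; simp
  rw [← this, integral_finsetSum _ fun a _ => slInt μ (continuous_finsetSum _ fun b _ => hc a b)]
  refine Finset.sum_congr rfl fun a _ => ?_
  rw [integral_finsetSum _ fun b _ => slInt μ (hc a b)]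
  exact Finset.sum_congr rfl fun b _ => slF_single T μ b a

lemma slF_le [Nontrivial ι] (T : Matrix ι ι ℂ) (hT : T.trace = 0)
    (μ : Measure (Matrix.unitaryGroup ι ℂ))
    [IsProbabilityMeasure μ] [μ.IsMulRightInvariant] (M : Matrix ι ι ℂ) :
    (Fintype.card ι : ℝ) * ((Fintype.card ι : ℝ) - 1) * slF T μ M
      ≤ 4 * ((T * star T).trace).re * ((M * star M).trace).re := by
  obtain ⟨s, r, hr, h⟩ := slB_struct T hT μ
  have hherm := slF_herm T μ s r h
  have hpair : ∀ a b : ι, a ≠ b →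
      s ≤ slF T μ (Matrix.single a b 1) + slF T μ (Matrix.single b a 1) := by
    intro a b hab
    have h1 := hherm (Matrix.single a b 1 + Matrix.single b a 1) (by
      rw [Matrix.IsHermitian, Matrix.conjTranspose_add, Matrix.conjTranspose_single,
        Matrix.conjTranspose_single, add_comm]; simp)
    have h2 := slF_add_le T μ (Matrix.single a b 1) (Matrix.single b a 1)
    rw [h1] at h2
    have h3 : ((Matrix.single a b (1:ℂ) + Matrix.single b a 1) *
        (Matrix.single a b 1 + Matrix.single b a 1)).trace = 2 := by
      simp only [mul_add, add_mul, Matrix.single_mul_single_same, Matrix.trace_add]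
      rw [Matrix.single_mul_single_of_ne _ _ _ _ hab.symm,
        Matrix.single_mul_single_of_ne _ _ _ _ hab]
      simp; norm_num
    have h4 : (Matrix.single a b (1:ℂ) + Matrix.single b a 1).trace = 0 := by
      rw [Matrix.trace_add, Matrix.trace_single_eq_of_ne _ _ _ hab,
        Matrix.trace_single_eq_of_ne _ _ _ hab.symm, add_zero]
    rw [h3, h4] at h2
    norm_num at h2
    linarith
  have hsum : (Fintype.card ι : ℝ) * ((Fintype.card ι : ℝ) - 1) * s
      ≤ 2 * ((T * star T).trace).re := by
    have e1 : ∑ a : ι, ∑ b : ι, (if a = b then 0 else s) ≤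
        ∑ a : ι, ∑ b : ι, (slF T μ (Matrix.single a b 1) + slF T μ (Matrix.single b a 1)) := by
      refine Finset.sum_le_sum fun a _ => Finset.sum_le_sum fun b _ => ?_
      split_ifs with hab
      · exact add_nonneg (slF_nonneg _ _ _) (slF_nonneg _ _ _)
      · exact hpair a b hab
    have e2 : ∑ a : ι, ∑ b : ι, (if a = b then 0 else s) =
        (Fintype.card ι : ℝ) * ((Fintype.card ι : ℝ) - 1) * s := by
      have : ∀ a b : ι, (if a = b then 0 else s) = s - (if a = b then s else 0) := by
        intro a b; split_ifs <;> simp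
      simp only [this, Finset.sum_sub_distrib]
      simp
      ring
    simp only [Finset.sum_add_distrib] at e1
    have e3 : ∑ a : ι, ∑ b : ι, slF T μ (Matrix.single a b 1) = ((T * star T).trace).re := by
      rw [Finset.sum_comm]; exact slF_sum_single T μ
    rw [slF_sum_single, e3, e2] at e1
    linarith
  have hHle : ∀ H : Matrix ι ι ℂ, H.IsHermitian → slF T μ H ≤ s * ((H * H).trace).re := by
    intro H hH
    rw [hherm H hH]
    nlinarith [sq_nonneg H.trace.re, mul_nonneg (neg_nonneg.2 hr) (sq_nonneg H.trace.re)]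
  set H := (1/2 : ℂ) • (M + star M) with hHdef
  set K := (-Complex.I/2 : ℂ) • (M - star M) with hKdef
  have hH : H.IsHermitian := by
    rw [Matrix.IsHermitian, ← Matrix.star_eq_conjTranspose, hHdef, star_smul, star_add, star_star,
      add_comm]
    simp
  have hK : K.IsHermitian := by
    rw [Matrix.IsHermitian, ← Matrix.star_eq_conjTranspose, hKdef, star_smul, star_sub, star_star,
      ← neg_sub M, smul_neg, ← neg_smul]
    simp [neg_div]
  have hM : M = H + Complex.I • K := by
    rw [hHdef, hKdef, smul_smul]
    have : Complex.I * (-Complex.I/2) = 1/2 := by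
      linear_combination (-1/2) * Complex.I_mul_I
    rw [this, ← smul_add]
    have : M + star M + (M - star M) = (2:ℂ) • M := by rw [two_smul]; abel
    rw [this, smul_smul]; norm_num
  have hN : (H * H).trace + (K * K).trace = (M * star M).trace := by
    rw [hHdef, hKdef]
    simp only [Matrix.smul_mul, Matrix.mul_smul, Matrix.trace_smul, mul_add, add_mul,
      mul_sub, sub_mul, Matrix.trace_add, Matrix.trace_sub, smul_eq_mul]
    rw [Matrix.trace_mul_comm (star M) M]
    linear_combination (1/4) * ((M * M).trace - 2 * (M * star M).trace
      + (star M * star M).trace) * Complex.I_mul_I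
  have hf : slF T μ M ≤ 2 * s * ((M * star M).trace).re := by
    have h1 := slF_add_le T μ H (Complex.I • K)
    rw [← hM, slF_smul T μ Complex.I K, Complex.norm_I] at h1
    have h2 := hHle H hH
    have h3 := hHle K hK
    rw [← hN, Complex.add_re]
    linarith
  have hfro : 0 ≤ ((M * star M).trace).re := by
    have := slA_frob M 1
    rw [← this]; positivity
  have hn : (1:ℝ) ≤ Fintype.card ι := by exact_mod_cast Fintype.card_pos
  have hnn : 0 ≤ (Fintype.card ι : ℝ) * ((Fintype.card ι : ℝ) - 1) := by
    apply mul_nonneg <;> linarith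
  calc _ ≤ (Fintype.card ι : ℝ) * ((Fintype.card ι : ℝ) - 1) * (2 * s * ((M * star M).trace).re) :=
        mul_le_mul_of_nonneg_left hf hnn
    _ = 2 * ((Fintype.card ι : ℝ) * ((Fintype.card ι : ℝ) - 1) * s) * ((M * star M).trace).re := by
        ring
    _ ≤ 2 * (2 * ((T * star T).trace).re) * ((M * star M).trace).re := by gcongr
    _ = _ := by ring

end helper

section slice
variable (P d m : ℕ) (hP : 0 < P)

/-- traceless diagonal matrix -/
noncomputable def slT : Matrix (Fin P × Fin d) (Fin P × Fin d) ℂ :=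
  Matrix.diagonal fun x => if x.1 = ⟨0, hP⟩ then (P : ℂ) - 1 else -1

lemma slT_trace : (slT P d hP).trace = 0 := by
  have : ∀ x : Fin P, (if x = ⟨0, hP⟩ then (P : ℂ) - 1 else -1) =
      (if x = ⟨0, hP⟩ then (P : ℂ) else 0) - 1 := by intro x; split_ifs <;> simp
  rw [slT, Matrix.trace_diagonal, Fintype.sum_prod_type]
  simp only [this, Finset.sum_sub_distrib, Finset.sum_const, ← Finset.smul_sum, Finset.sum_ite_eq', Finset.mem_univ, if_true]
  simp
  ring

lemma slT_frob : ((slT P d hP * star (slT P d hP)).trace).re = (P * d : ℝ) * (P - 1) := by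
  have : ∀ x : Fin P, (if x = ⟨0, hP⟩ then (P : ℂ) - 1 else -1) *
      star (if x = ⟨0, hP⟩ then (P : ℂ) - 1 else -1) =
      (if x = ⟨0, hP⟩ then (P : ℂ) ^ 2 - 2 * P else 0) + 1 := by
    intro x; split_ifs <;> simp; ring
  have h2 : (slT P d hP * star (slT P d hP)).trace = (P * d : ℂ) * (P - 1) := by
    rw [slT, Matrix.star_eq_conjTranspose, Matrix.diagonal_conjTranspose,
      Matrix.diagonal_mul_diagonal, Matrix.trace_diagonal, Fintype.sum_prod_type]
    simp only [Pi.star_apply, this, Finset.sum_const, ← Finset.smul_sum, Finset.sum_add_distrib,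
      Finset.sum_ite_eq', Finset.mem_univ, if_true]
    simp
    ring
  rw [h2]
  have h3 : (P * d : ℂ) * (P - 1) = (((P * d : ℝ) * (P - 1) : ℝ) : ℂ) := by push_cast; ring
  rw [h3, Complex.ofReal_re]

lemma slA_slT (U : Matrix.unitaryGroup (Fin P × Fin d) ℂ) (x x' : Fin P × Fin d) :
    slA (slT P d hP) U x x' = (P : ℂ) * ∑ j, conj ((U : Matrix (Fin P × Fin d) (Fin P × Fin d) ℂ) (⟨0, hP⟩, j) x) *
      (U : Matrix (Fin P × Fin d) (Fin P × Fin d) ℂ) (⟨0, hP⟩, j) x' - (if x = x' then 1 else 0) := by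
  have h := Matrix.mem_unitaryGroup_iff'.1 U.2
  have h1 := congrFun (congrFun h x) x'
  rw [Matrix.mul_apply, Matrix.one_apply] at h1
  rw [← h1, slA, slT, Matrix.mul_apply]
  simp only [Matrix.mul_diagonal, Matrix.star_apply, Complex.star_def]
  have : ∀ k : Fin P × Fin d, (if k.1 = ⟨0, hP⟩ then (P : ℂ) - 1 else -1) =
      (if k.1 = ⟨0, hP⟩ then (P : ℂ) else 0) - 1 := by intro x; split_ifs <;> simp
  simp only [this, mul_sub, sub_mul, Finset.sum_sub_distrib, mul_one]
  congr 1
  rw [Fintype.sum_prod_type, Finset.sum_comm, Finset.mul_sum]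
  refine Finset.sum_congr rfl fun j _ => ?_
  simp only [mul_ite, ite_mul, mul_zero, zero_mul, Finset.sum_ite_eq', Finset.mem_univ, if_true]
  ring

/-- cross matrix -/
noncomputable def slM (ψ₁ ψ₂ : (Fin P × Fin d) × Fin m → ℂ) :
    Matrix (Fin P × Fin d) (Fin P × Fin d) ℂ :=
  fun x' x => ∑ y, ψ₂ (x', y) * conj (ψ₁ (x, y))

lemma slice_eq (U : Matrix.unitaryGroup (Fin P × Fin d) ℂ)
    (ψ₁ ψ₂ : (Fin P × Fin d) × Fin m → ℂ) :
    inn (sliceV P d m hP U ψ₁) (sliceV P d m hP U ψ₂) - inn ψ₁ ψ₂ =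
      (slA (slT P d hP) U * slM P d m ψ₁ ψ₂).trace := by
  have hsq : (Real.sqrt P : ℂ) * (Real.sqrt P : ℂ) = P := by
    rw [← Complex.ofReal_mul, Real.mul_self_sqrt (Nat.cast_nonneg P)]; simp
  have hV : inn (sliceV P d m hP U ψ₁) (sliceV P d m hP U ψ₂) =
      ∑ x, ∑ x', ∑ y, ∑ j, (P : ℂ) * (conj ((U : Matrix (Fin P × Fin d) (Fin P × Fin d) ℂ) (⟨0, hP⟩, j) x) *
      (U : Matrix (Fin P × Fin d) (Fin P × Fin d) ℂ) (⟨0, hP⟩, j) x') * (ψ₂ (x', y) * conj (ψ₁ (x, y))) := by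
    unfold inn sliceV
    have e : ∀ (j : Fin d) (y : Fin m),
        conj ((Real.sqrt P : ℂ) * ∑ x, (U : Matrix (Fin P × Fin d) (Fin P × Fin d) ℂ) (⟨0, hP⟩, j) x * ψ₁ (x, y)) *
        ((Real.sqrt P : ℂ) * ∑ x, (U : Matrix (Fin P × Fin d) (Fin P × Fin d) ℂ) (⟨0, hP⟩, j) x * ψ₂ (x, y)) =
        ∑ x, ∑ x', (P : ℂ) * (conj ((U : Matrix (Fin P × Fin d) (Fin P × Fin d) ℂ) (⟨0, hP⟩, j) x) *
      (U : Matrix (Fin P × Fin d) (Fin P × Fin d) ℂ) (⟨0, hP⟩, j) x') * (ψ₂ (x', y) * conj (ψ₁ (x, y))) := by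
      intro j y
      rw [map_mul, Complex.conj_ofReal, mul_mul_mul_comm, hsq, map_sum, Finset.sum_mul_sum,
        Finset.mul_sum]
      refine Finset.sum_congr rfl fun x _ => ?_
      rw [Finset.mul_sum]
      refine Finset.sum_congr rfl fun x' _ => ?_
      rw [map_mul]; ring
    rw [Fintype.sum_prod_type]
    simp only [e]
    calc _ = ∑ j, ∑ x, ∑ x', ∑ y, (P : ℂ) * (conj ((U : Matrix (Fin P × Fin d) (Fin P × Fin d) ℂ) (⟨0, hP⟩, j) x) *
      (U : Matrix (Fin P × Fin d) (Fin P × Fin d) ℂ) (⟨0, hP⟩, j) x') * (ψ₂ (x', y) * conj (ψ₁ (x, y))) := by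
          refine Finset.sum_congr rfl fun j _ => ?_
          rw [Finset.sum_comm]
          exact Finset.sum_congr rfl fun x _ => Finset.sum_comm
      _ = _ := by
          rw [Finset.sum_comm]
          refine Finset.sum_congr rfl fun x _ => ?_
          rw [Finset.sum_comm]
          exact Finset.sum_congr rfl fun x _ => Finset.sum_comm
  have hI : inn ψ₁ ψ₂ = ∑ x, ∑ x', ∑ y,
      (if x = x' then 1 else 0) * (ψ₂ (x', y) * conj (ψ₁ (x, y))) := by
    unfold inn
    rw [Fintype.sum_prod_type]
    refine Finset.sum_congr rfl fun x _ => ?_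
    rw [Finset.sum_comm]
    refine Finset.sum_congr rfl fun y _ => ?_
    simp only [ite_mul, one_mul, zero_mul, Finset.sum_ite_eq, Finset.mem_univ, if_true]
    ring
  rw [hV, hI, Matrix.trace]
  simp only [Matrix.diag_apply, Matrix.mul_apply, slA_slT, slM, ← Finset.sum_sub_distrib]
  refine Finset.sum_congr rfl fun x _ => Finset.sum_congr rfl fun x' _ => ?_
  rw [Finset.mul_sum]
  refine Finset.sum_congr rfl fun y _ => ?_
  rw [sub_mul, Finset.mul_sum, Finset.sum_mul]

lemma inn_self {κ : Type*} [Fintype κ] (f : κ → ℂ) (h : inn f f = 1) : ∑ x, ‖f x‖ ^ 2 = 1 := by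
  unfold inn at h
  have := congrArg Complex.re h
  rw [Complex.re_sum] at this
  rw [← Complex.one_re, ← this]
  refine Finset.sum_congr rfl fun x _ => ?_
  rw [Complex.conj_mul']
  norm_cast

lemma slM_frob (ψ₁ ψ₂ : (Fin P × Fin d) × Fin m → ℂ) (h1 : inn ψ₁ ψ₁ = 1) (h2 : inn ψ₂ ψ₂ = 1) :
    ((slM P d m ψ₁ ψ₂ * star (slM P d m ψ₁ ψ₂)).trace).re ≤ 1 := by
  rw [← slA_frob _ 1]
  have hs : ∀ a b, slA (slM P d m ψ₁ ψ₂) 1 a b = slM P d m ψ₁ ψ₂ a b := by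
    intro a b; simp [slA]
  simp only [hs]
  have h1' := inn_self _ h1
  have h2' := inn_self _ h2
  rw [Fintype.sum_prod_type] at h1' h2'
  calc _ ≤ ∑ a, ∑ b, (∑ y, ‖ψ₂ (a, y)‖ ^ 2) * (∑ y, ‖ψ₁ (b, y)‖ ^ 2) := by
        refine Finset.sum_le_sum fun a _ => Finset.sum_le_sum fun b _ => ?_
        refine le_trans ?_ (Finset.sum_mul_sq_le_sq_mul_sq _ _ _)
        gcongr
        refine (norm_sum_le _ _).trans (le_of_eq ?_)
        simp
    _ = 1 := by rw [← Finset.sum_mul_sum, h1', h2', one_mul]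

lemma slice_upper (hP2 : 2 ≤ P) (hd : 1 ≤ d)
    (μ : Measure (Matrix.unitaryGroup (Fin P × Fin d) ℂ))
    [IsProbabilityMeasure μ] [μ.IsMulRightInvariant]
    (ψ₁ ψ₂ : (Fin P × Fin d) × Fin m → ℂ) (h1 : inn ψ₁ ψ₁ = 1) (h2 : inn ψ₂ ψ₂ = 1) :
    ∫ U, ‖inn (sliceV P d m hP U ψ₁) (sliceV P d m hP U ψ₂) - inn ψ₁ ψ₂‖ ^ 2 ∂μ
      ≤ 12 * (((P : ℝ) - 1) / ((P : ℝ) * d + 1)) := by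
  simp only [slice_eq]
  have : Nontrivial (Fin P) := Fin.nontrivial_iff_two_le.2 hP2
  have : Nonempty (Fin d) := ⟨⟨0, hd⟩⟩
  have h := slF_le (slT P d hP) (slT_trace P d hP) μ (slM P d m ψ₁ ψ₂)
  rw [slT_frob] at h
  have hM := slM_frob P d m ψ₁ ψ₂ h1 h2
  change slF (slT P d hP) μ (slM P d m ψ₁ ψ₂) ≤ _
  have h0 := slF_nonneg (slT P d hP) μ (slM P d m ψ₁ ψ₂)
  generalize slF (slT P d hP) μ (slM P d m ψ₁ ψ₂) = f at *
  simp only [Fintype.card_prod, Fintype.card_fin, Nat.cast_mul] at h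
  have hp : (2:ℝ) ≤ P := by exact_mod_cast hP2
  have hdd : (1:ℝ) ≤ d := by exact_mod_cast hd
  have hn : (2:ℝ) ≤ P * d := by nlinarith
  generalize (P * d : ℝ) = n at *
  have h3 : n * ((n - 1) * f) ≤ n * (4 * (P - 1)) := by
    have : 4 * (n * ((P:ℝ) - 1)) * ((slM P d m ψ₁ ψ₂ * star (slM P d m ψ₁ ψ₂)).trace).re ≤
      4 * (n * ((P:ℝ) - 1)) * 1 := mul_le_mul_of_nonneg_left hM (by
        have : 0 ≤ n * ((P:ℝ) - 1) := mul_nonneg (by linarith) (by linarith)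
        linarith)
    linarith
  have h4 := le_of_mul_le_mul_left h3 (by linarith)
  rw [← mul_div_assoc, le_div_iff₀ (by linarith)]
  nlinarith

lemma slice_lower (hP2 : 2 ≤ P) (hd : 1 ≤ d) (hm : 1 ≤ m)
    (μ : Measure (Matrix.unitaryGroup (Fin P × Fin d) ℂ))
    [IsProbabilityMeasure μ] (ε : ℝ)
    (h : ∀ ψ₁ ψ₂ : (Fin P × Fin d) × Fin m → ℂ, inn ψ₁ ψ₁ = 1 → inn ψ₂ ψ₂ = 1 →
    ∫ U, ‖inn (sliceV P d m hP U ψ₁) (sliceV P d m hP U ψ₂) - inn ψ₁ ψ₂‖ ^ 2 ∂μ ≤ ε) :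
    ((P : ℝ) - 1) / ((P : ℝ) * d + 1) ≤ ε := by
  simp only [slice_eq] at h
  have hs := slF_sum_single (slT P d hP) μ
  rw [slT_frob] at hs
  let y0 : Fin m := ⟨0, hm⟩
  have key : ∀ a b, slF (slT P d hP) μ (Matrix.single b a 1) ≤ ε := by
    intro a b
    have hu : ∀ a, inn (Pi.single (a, y0) 1 : (Fin P × Fin d) × Fin m → ℂ)
        (Pi.single (a, y0) 1) = 1 := by
      intro a
      simp [inn, Pi.single_apply]
    have := h (Pi.single (a, y0) 1) (Pi.single (b, y0) 1) (hu a) (hu b)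
    have hM : slM P d m (Pi.single (a, y0) 1) (Pi.single (b, y0) 1) = Matrix.single b a 1 := by
      ext x' x
      simp only [slM, Pi.single_apply, Matrix.single_apply, Prod.mk.injEq]
      simp only [eq_comm (a := b), eq_comm (a := a)]
      by_cases h1 : x' = b <;> by_cases h2 : x = a <;> simp [h1, h2]
    rw [hM] at this
    exact this
  have hle : (P * d : ℝ) * (P - 1) ≤ (P * d) * (P * d) * ε := by
    rw [← hs]
    calc _ ≤ ∑ a : Fin P × Fin d, ∑ b : Fin P × Fin d, ε :=
          Finset.sum_le_sum fun a _ => Finset.sum_le_sum fun b _ => key a b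
      _ = _ := by simp; ring
  have hp : (2:ℝ) ≤ P := by exact_mod_cast hP2
  have hdd : (1:ℝ) ≤ d := by exact_mod_cast hd
  have hn : (2:ℝ) ≤ P * d := by nlinarith
  generalize (P * d : ℝ) = n at *
  rw [mul_assoc] at hle
  have h4 := le_of_mul_le_mul_left hle (by linarith)
  rw [div_le_iff₀ (by linarith)]
  have : 0 ≤ ε := by
    by_contra hc
    push Not at hc
    nlinarith
  nlinarith

end slice

lemma slBC (P d : ℕ → ℕ) (hP : ∀ N, 2 ≤ P N) (hd : ∀ N, 1 ≤ d N) :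
    (∀ α : ℝ, 0 < α → ∃ C : ℝ, ∀ N : ℕ, 1 ≤ N →
          ((P N : ℝ) - 1) / ((P N : ℝ) * (d N : ℝ) + 1) ≤ C * (N : ℝ) ^ (-α))
      ↔ (∀ k : ℕ, Filter.Tendsto (fun N : ℕ => (N : ℝ) ^ k / (d N : ℝ))
          Filter.atTop (nhds 0)) := by
  have hp : ∀ N, (2:ℝ) ≤ P N := fun N => by exact_mod_cast hP N
  have hdd : ∀ N, (1:ℝ) ≤ d N := fun N => by exact_mod_cast hd N
  constructor
  · intro h k
    obtain ⟨C, hC⟩ := h (k + 1) (by positivity)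
    have hlim : Filter.Tendsto (fun N : ℕ => 4 * C * (1 / (N : ℝ))) Filter.atTop (nhds 0) := by
      simpa using (tendsto_one_div_atTop_nhds_zero_nat (𝕜 := ℝ)).const_mul (4 * C)
    refine squeeze_zero' (Filter.Eventually.of_forall fun N => by positivity) ?_ hlim
    filter_upwards [Filter.eventually_ge_atTop 1] with N hN
    have hN' : (0:ℝ) < N := by exact_mod_cast hN
    have h1 := hC N hN
    have h2 : 1 / (4 * (d N : ℝ)) ≤ ((P N : ℝ) - 1) / ((P N : ℝ) * (d N : ℝ) + 1) := by
      have := hp N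
      have := hdd N
      rw [div_le_div_iff₀ (by positivity) (by positivity)]
      nlinarith
    have h3 : (N : ℝ) ^ (-((k:ℝ) + 1)) = 1 / ((N:ℝ) ^ k * N) := by
      rw [Real.rpow_neg hN'.le, Real.rpow_add hN', Real.rpow_natCast, Real.rpow_one, one_div]
    rw [h3] at h1
    have h4 := h2.trans h1
    have hdp : (0:ℝ) < d N := by linarith [hdd N]
    calc (N : ℝ) ^ k / (d N : ℝ) = 4 * (N:ℝ) ^ k * (1 / (4 * (d N : ℝ))) := by field_simp
      _ ≤ 4 * (N:ℝ) ^ k * (C * (1 / ((N:ℝ) ^ k * N))) := by gcongr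
      _ = _ := by field_simp
  · intro h α hα
    obtain ⟨k, hk⟩ := exists_nat_ge α
    obtain ⟨C, hC⟩ := (h k).bddAbove_range
    refine ⟨C, fun N hN => ?_⟩
    have h1 : (N : ℝ) ^ k / (d N : ℝ) ≤ C := hC ⟨N, rfl⟩
    have hN1 : (1:ℝ) ≤ N := by exact_mod_cast hN
    have hN' : (0:ℝ) < N := by linarith
    have hdp : (0:ℝ) < d N := by linarith [hdd N]
    have hC0 : 0 ≤ C := le_trans (by positivity) h1
    calc ((P N : ℝ) - 1) / ((P N : ℝ) * (d N : ℝ) + 1) ≤ 1 / d N := by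
          have := hp N
          rw [div_le_div_iff₀ (by positivity) hdp]
          nlinarith
      _ = (N : ℝ) ^ k / (d N : ℝ) * (N : ℝ) ^ (-(k:ℝ)) := by
          rw [Real.rpow_neg hN'.le, Real.rpow_natCast]; field_simp
      _ ≤ C * (N : ℝ) ^ (-α) := by
          gcongr

/-- **Single-layer form of the main theorem: emergence ↔ superpolynomial χ-entropy.**
Let `P, d, m : ℕ → ℕ` with `P_N ≥ 2`, `d_N, m_N ≥ 1`, and for each `N` let `μ_N` be the
Haar probability measure (the left- and right-invariant Borel probability measure) on the
unitary group `U(P_N d_N)`.  The following are equivalent: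
(a) for every `α > 0` there is `C` with
    `∫ |⟨ψ₁, V_N(U)†V_N(U) ψ₂⟩ − ⟨ψ₁, ψ₂⟩|² dμ_N(U) ≤ C·N^{−α}` for all `N ≥ 1` and all
    unit vectors `ψ₁, ψ₂`;
(b) for every `α > 0` there is `C` with `(P_N − 1)/(P_N d_N + 1) ≤ C·N^{−α}` for `N ≥ 1`;
(c) for every `k : ℕ`, `N^k / d_N → 0`. -/
theorem sliceV_emergence_iff_superpolynomial_chi (P d m : ℕ → ℕ)
    (hP : ∀ N, 2 ≤ P N) (hd : ∀ N, 1 ≤ d N) (hm : ∀ N, 1 ≤ m N)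
    (μ : ∀ N, Measure (Matrix.unitaryGroup (Fin (P N) × Fin (d N)) ℂ))
    (hprob : ∀ N, IsProbabilityMeasure (μ N))
    (hleft : ∀ N, (μ N).IsMulLeftInvariant)
    (hright : ∀ N, (μ N).IsMulRightInvariant) :
    ((∀ α : ℝ, 0 < α → ∃ C : ℝ, ∀ N : ℕ, 1 ≤ N →
        ∀ ψ₁ ψ₂ : (Fin (P N) × Fin (d N)) × Fin (m N) → ℂ,
          inn ψ₁ ψ₁ = 1 → inn ψ₂ ψ₂ = 1 →
          ∫ U, ‖inn (sliceV (P N) (d N) (m N) (lt_of_lt_of_le two_pos (hP N)) U ψ₁)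
                    (sliceV (P N) (d N) (m N) (lt_of_lt_of_le two_pos (hP N)) U ψ₂)
                  - inn ψ₁ ψ₂‖ ^ 2 ∂(μ N)
            ≤ C * (N : ℝ) ^ (-α))
      ↔ (∀ α : ℝ, 0 < α → ∃ C : ℝ, ∀ N : ℕ, 1 ≤ N →
          ((P N : ℝ) - 1) / ((P N : ℝ) * (d N : ℝ) + 1) ≤ C * (N : ℝ) ^ (-α)))
    ∧ ((∀ α : ℝ, 0 < α → ∃ C : ℝ, ∀ N : ℕ, 1 ≤ N →
          ((P N : ℝ) - 1) / ((P N : ℝ) * (d N : ℝ) + 1) ≤ C * (N : ℝ) ^ (-α))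
      ↔ (∀ k : ℕ, Filter.Tendsto (fun N : ℕ => (N : ℝ) ^ k / (d N : ℝ))
          Filter.atTop (nhds 0))) := by
  refine ⟨⟨fun h α hα => ?_, fun h α hα => ?_⟩, slBC P d hP hd⟩
  · obtain ⟨C, hC⟩ := h α hα
    refine ⟨C, fun N hN => ?_⟩
    have := hprob N
    exact slice_lower (P N) (d N) (m N) _ (hP N) (hd N) (hm N) (μ N) _ (hC N hN)
  · obtain ⟨C, hC⟩ := h α hα
    refine ⟨12 * C, fun N hN ψ₁ ψ₂ h1 h2 => ?_⟩
    have := hprob N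
    have := hright N
    refine (slice_upper (P N) (d N) (m N) _ (hP N) (hd N) (μ N) ψ₁ ψ₂ h1 h2).trans ?_
    have := hC N hN
    linarith
end

section
/- Overlap–purity inequality: for all natural numbers a, b ≥ 1 and all unit vectors ψ₁, ψ₂ ∈ ℂ^a ⊗ ℂ^b with reduced density matrices ρ₁, ρ₂ on ℂ^b, one has 0 ≤ tr(ρ₁ρ₂) ≤ 1 and |⟨ψ₁, ψ₂⟩|² ≤ a · tr(ρ₁ρ₂). (In particular, the bracket P·d·tr(ψ₁^out ψ₂^out) − |⟨ψ₁, ψ₂⟩|² appearing in the fluctuation formula for the single-layer slice-normal map is nonnegative.) -/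
open ComplexConjugate
open scoped ComplexOrder

/-- The reduced density matrix of `ψ ∈ ℂ^a ⊗ ℂ^b` on `ℂ^b`:
`ρ(y, y') = ∑ x, ψ(x, y) · conj (ψ(x, y'))`. -/
noncomputable def rhoB (a b : ℕ) (ψ : Fin a × Fin b → ℂ) : Matrix (Fin b) (Fin b) ℂ :=
  fun y y' => ∑ x : Fin a, ψ (x, y) * conj (ψ (x, y'))

lemma trace_eq_aux (a b : ℕ) (ψ₁ ψ₂ : Fin a × Fin b → ℂ) :
    (rhoB a b ψ₁ * rhoB a b ψ₂).trace =
      ((∑ x : Fin a, ∑ x' : Fin a, ‖∑ y : Fin b, conj (ψ₁ (x, y)) * ψ₂ (x', y)‖ ^ 2 : ℝ) : ℂ) := by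
  push_cast
  simp only [← Complex.conj_mul', map_sum, map_mul, Complex.conj_conj, Finset.sum_mul_sum,
    Matrix.trace, Matrix.diag, Matrix.mul_apply, rhoB]
  calc _ = ∑ y : Fin b, ∑ x : Fin a, ∑ x' : Fin a, ∑ y' : Fin b,
        ψ₁ (x, y) * conj (ψ₁ (x, y')) * (ψ₂ (x', y') * conj (ψ₂ (x', y))) := by
        refine Finset.sum_congr rfl fun y _ => ?_
        rw [Finset.sum_comm]
        refine Finset.sum_congr rfl fun x _ => ?_
        rw [Finset.sum_comm]
    _ = _ := by
        rw [Finset.sum_comm]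
        refine Finset.sum_congr rfl fun x _ => ?_
        rw [Finset.sum_comm]
        refine Finset.sum_congr rfl fun x' _ => ?_
        refine Finset.sum_congr rfl fun y _ => ?_
        refine Finset.sum_congr rfl fun y' _ => ?_
        ring

lemma cs_aux {ι : Type*} (s : Finset ι) (f g : ι → ℂ) :
    ‖∑ y ∈ s, conj (f y) * g y‖ ^ 2 ≤ (∑ y ∈ s, ‖f y‖ ^ 2) * ∑ y ∈ s, ‖g y‖ ^ 2 := by
  refine le_trans ?_ (Finset.sum_mul_sq_le_sq_mul_sq s (fun y => ‖f y‖) (fun y => ‖g y‖))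
  gcongr
  refine (norm_sum_le _ _).trans (le_of_eq ?_)
  simp

lemma norm_aux (a b : ℕ) (ψ : Fin a × Fin b → ℂ) (h : inn ψ ψ = 1) :
    ∑ x : Fin a, ∑ y : Fin b, ‖ψ (x, y)‖ ^ 2 = 1 := by
  rw [← Fintype.sum_prod_type (f := fun p => ‖ψ p‖ ^ 2)]
  have : ((∑ p, ‖ψ p‖ ^ 2 : ℝ) : ℂ) = 1 := by
    rw [← h, inn]
    push_cast
    simp only [Complex.conj_mul']
  exact_mod_cast this

/-- **Overlap–purity inequality.**  For `a, b ≥ 1` and unit vectors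
`ψ₁, ψ₂ ∈ ℂ^a ⊗ ℂ^b` with reduced density matrices `ρ₁, ρ₂` on `ℂ^b`:
`0 ≤ tr(ρ₁ρ₂) ≤ 1` and `|⟨ψ₁, ψ₂⟩|² ≤ a · tr(ρ₁ρ₂)`  (so the bracket
`P·d·tr(ψ₁^out ψ₂^out) − |⟨ψ₁, ψ₂⟩|²` in the fluctuation formula is nonnegative). -/
theorem overlap_purity_inequality (a b : ℕ) (ha : 0 < a) (hb : 0 < b)
    (ψ₁ ψ₂ : Fin a × Fin b → ℂ) (hψ₁ : inn ψ₁ ψ₁ = 1) (hψ₂ : inn ψ₂ ψ₂ = 1) :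
    0 ≤ (rhoB a b ψ₁ * rhoB a b ψ₂).trace
    ∧ (rhoB a b ψ₁ * rhoB a b ψ₂).trace ≤ 1
    ∧ ((‖inn ψ₁ ψ₂‖ : ℂ) ^ 2 ≤ (a : ℂ) * (rhoB a b ψ₁ * rhoB a b ψ₂).trace) := by
  rw [trace_eq_aux]
  refine ⟨?_, ?_, ?_⟩
  · rw [Complex.zero_le_real]
    positivity
  · have : (∑ x : Fin a, ∑ x' : Fin a, ‖∑ y : Fin b, conj (ψ₁ (x, y)) * ψ₂ (x', y)‖ ^ 2) ≤ 1 := by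
      calc _ ≤ ∑ x : Fin a, ∑ x' : Fin a,
            (∑ y : Fin b, ‖ψ₁ (x, y)‖ ^ 2) * ∑ y : Fin b, ‖ψ₂ (x', y)‖ ^ 2 :=
            Finset.sum_le_sum fun x _ => Finset.sum_le_sum fun x' _ => cs_aux _ _ _
        _ = 1 := by
            rw [← Finset.sum_mul_sum, norm_aux a b ψ₁ hψ₁, norm_aux a b ψ₂ hψ₂, one_mul]
    exact_mod_cast this
  · have : ‖inn ψ₁ ψ₂‖ ^ 2 ≤ (a : ℝ) *
        ∑ x : Fin a, ∑ x' : Fin a, ‖∑ y : Fin b, conj (ψ₁ (x, y)) * ψ₂ (x', y)‖ ^ 2 := by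
      rw [inn, Fintype.sum_prod_type]
      calc _ ≤ (∑ x : Fin a, ‖∑ y : Fin b, conj (ψ₁ (x, y)) * ψ₂ (x, y)‖) ^ 2 := by
            gcongr
            exact norm_sum_le _ _
        _ ≤ (a : ℝ) * ∑ x : Fin a, ‖∑ y : Fin b, conj (ψ₁ (x, y)) * ψ₂ (x, y)‖ ^ 2 := by
            simpa using sq_sum_le_card_mul_sum_sq (s := (Finset.univ : Finset (Fin a)))
              (f := fun x => ‖∑ y : Fin b, conj (ψ₁ (x, y)) * ψ₂ (x, y)‖)
        _ ≤ _ := by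
            gcongr with x _
            exact Finset.single_le_sum
              (f := fun x' => ‖∑ y : Fin b, conj (ψ₁ (x, y)) * ψ₂ (x', y)‖ ^ 2)
              (fun _ _ => by positivity) (Finset.mem_univ x)
    exact_mod_cast this
end
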